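/- arXiv:math/9809066 — 2 statements merged into one kernel-verified Lean document; each statement's English description precedes it below -/
import Mathlib

section
/- Let p ≥ 4 be an integer, 1 ≤ a ≤ p−2 and 2 ≤ b ≤ p−1. For every integer L ≥ 2 and every real q with 0 < q < 1, B̃^p_{a,b}(L,b+2) = B^p_{a,b+1}(L−1,b+2) + (q^{L−1} − 1) B^p_{a,b+1}(L−2,b+2) + q^{a−b} ( B^p_{a,b−1}(L−1,b) + (q^{L−1} − 1) B^p_{a,b−1}(L−2,b) ) + B̃^p_{a,b}(L−1,b+2) + q^{L−2}(q^{L−1} − 1) B̃^p_{a,b}(L−2,b+2). -/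
open Finset

noncomputable section

/-- `(q)_k = ∏_{j=1}^k (1 - q^j)`. -/
def qPoch (q : ℝ) (k : ℕ) : ℝ := ∏ j ∈ Finset.range k, (1 - q ^ (j + 1))

/-- The Andrews–Baxter `q`-trinomial coefficient `T^n(L,A)`. -/
def qTri (q : ℝ) (n : ℤ) (L : ℕ) (A : ℤ) : ℝ :=
  if |A| ≤ (L : ℤ) then
    ∑ j ∈ Finset.range (L + 1),
      if 0 ≤ (j : ℤ) + A ∧ 0 ≤ (L : ℤ) - 2 * j - A then
        q ^ ((j : ℤ) * ((j : ℤ) + A - n)) * qPoch q L /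
          (qPoch q j * qPoch q (((j : ℤ) + A).toNat) * qPoch q (((L : ℤ) - 2 * j - A).toNat))
      else 0
  else 0

/-- Bosonic polynomial `B^p_{a,b}(L,s)`. -/
def Bpoly (q : ℝ) (p a b s : ℤ) (L : ℕ) : ℝ :=
  ∑' j : ℤ,
    (q ^ (p * (p + 1) * j ^ 2 + j * ((p + 1) * a - p * s)) * qTri q 0 L (2 * p * j + a - b)
      - q ^ ((p * j + a) * ((p + 1) * j + s)) * qTri q 0 L (2 * p * j + a + b))

/-- Bosonic polynomial `B̃^p_{a,b}(L,s)`. -/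
def Btpoly (q : ℝ) (p a b s : ℤ) (L : ℕ) : ℝ :=
  ∑' j : ℤ,
    (q ^ (p * (p + 1) * j ^ 2 + j * ((p + 1) * a - p * s)) * qTri q 1 L (2 * p * j + a - b)
      - q ^ (p * (p + 1) * j ^ 2 + j * ((p + 1) * a + p * (s - 2)) + a * (s - 1) - b)
        * qTri q 1 L (2 * p * j + a + b))

/-- reciprocal of `(q)_k`, extended by zero to negative `k` -/
def gInv (q : ℝ) (k : ℤ) : ℝ := if 0 ≤ k then (qPoch q k.toNat)⁻¹ else 0

lemma gInv_neg (q : ℝ) {k : ℤ} (h : k < 0) : gInv q k = 0 := by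
  simp [gInv, not_le.mpr h]

lemma qPoch_succ (q : ℝ) (k : ℕ) : qPoch q (k + 1) = qPoch q k * (1 - q ^ (k + 1)) := by
  simp [qPoch, Finset.prod_range_succ]

lemma gInv_rec (q : ℝ) (hq0 : 0 < q) (hq1 : q < 1) (k : ℤ) :
    gInv q (k - 1) = (1 - q ^ k) * gInv q k := by
  rcases lt_trichotomy k 0 with h | h | h
  · rw [gInv_neg q h, gInv_neg q (by omega)]; ring
  · subst h; rw [gInv_neg q (by omega)]; simp
  · obtain ⟨n, rfl⟩ : ∃ n : ℕ, k = ((n + 1 : ℕ) : ℤ) := ⟨(k - 1).toNat, by omega⟩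
    have h1 : q ^ (n + 1) < 1 := pow_lt_one₀ hq0.le hq1 (by omega)
    have h2 : (1 - q ^ (n + 1)) ≠ 0 := by linarith
    have e : (((n + 1 : ℕ) : ℤ) - 1) = (n : ℤ) := by push_cast; ring
    rw [e]
    simp only [gInv, Int.natCast_nonneg, if_true, Int.toNat_natCast, qPoch_succ, zpow_natCast]
    rw [mul_inv, mul_comm (1 - q ^ (n + 1)), mul_assoc, inv_mul_cancel₀ h2, mul_one]

/-- summand of the trinomial -/
def tT (q : ℝ) (n : ℤ) (L : ℕ) (A j : ℤ) : ℝ :=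
  q ^ (j * (j + A - n)) * qPoch q L * (gInv q j * gInv q (j + A) * gInv q ((L : ℤ) - 2 * j - A))

lemma tT_zero (q : ℝ) (n : ℤ) (L : ℕ) (A j : ℤ)
    (h : ¬ (0 ≤ j ∧ 0 ≤ j + A ∧ 0 ≤ (L : ℤ) - 2 * j - A)) : tT q n L A j = 0 := by
  unfold tT
  by_cases h1 : 0 ≤ j
  · by_cases h2 : 0 ≤ j + A
    · rw [gInv_neg q (k := (L : ℤ) - 2 * j - A) (by omega)]; ring
    · rw [gInv_neg q (k := j + A) (by omega)]; ring
  · rw [gInv_neg q (k := j) (by omega)]; ring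

lemma hasSum_tT (q : ℝ) (n : ℤ) (L : ℕ) (A : ℤ) : HasSum (tT q n L A) (qTri q n L A) := by
  unfold qTri
  split_ifs with hA
  · have key : HasSum (tT q n L A)
        (∑ j ∈ (Finset.range (L + 1)).map Nat.castEmbedding, tT q n L A j) := by
      apply hasSum_sum_of_ne_finset_zero
      intro j hj
      apply tT_zero
      rintro ⟨h1, h2, h3⟩
      apply hj
      rw [Finset.mem_map]
      exact ⟨j.toNat, Finset.mem_range.mpr (by omega), by simpa using h1⟩
    rw [Finset.sum_map] at key
    convert key using 1
    refine Finset.sum_congr rfl fun j _ => ?_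
    simp only [Nat.castEmbedding_apply]
    split_ifs with h
    · simp only [tT, gInv, Int.natCast_nonneg, if_true, Int.toNat_natCast, h.1, h.2]
      rw [div_eq_mul_inv, mul_inv, mul_inv]
    · symm; apply tT_zero; tauto
  · have : tT q n L A = fun _ => 0 := by
      funext j
      apply tT_zero
      rintro ⟨h1, h2, h3⟩
      apply hA
      rw [abs_le]; omega
    rw [this]; exact hasSum_zero

/-- telescoping certificate -/
def tU (q : ℝ) (M : ℕ) (A j : ℤ) : ℝ :=
  qPoch q (M + 1) * q ^ ((M : ℤ) + 2 - 2 * j - A) * q ^ (j * (j + A - 1)) *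
    (gInv q (j - 1) * gInv q (j + A - 1) * gInv q ((M : ℤ) + 2 - 2 * j - A))

lemma hasSum_tU (q : ℝ) (M : ℕ) (A : ℤ) : ∃ s, HasSum (tU q M A) s := by
  refine ⟨_, hasSum_sum_of_ne_finset_zero (s := Finset.Icc (-(M + 10 : ℤ) - |A|) (M + 10 + |A|)) ?_⟩
  intro j hj
  rw [Finset.mem_Icc] at hj
  unfold tU
  by_cases h1 : 0 ≤ j - 1
  · by_cases h2 : 0 ≤ j + A - 1
    · rw [gInv_neg q (k := (M : ℤ) + 2 - 2 * j - A) ?_]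
      · ring
      · have := abs_nonneg A
        omega
    · rw [gInv_neg q (k := j + A - 1) (by omega)]; ring
  · rw [gInv_neg q (k := j - 1) (by omega)]; ring

lemma pointwise (q : ℝ) (hq0 : 0 < q) (hq1 : q < 1) (M : ℕ) (A j : ℤ) :
    tT q 1 (M + 2) A j = tT q 0 (M + 1) (A - 1) j + (q ^ (M + 1) - 1) * tT q 0 M (A - 1) j
      + q ^ A * (tT q 0 (M + 1) (A + 1) (j - 1) + (q ^ (M + 1) - 1) * tT q 0 M (A + 1) (j - 1))
      + tT q 1 (M + 1) A j + q ^ M * (q ^ (M + 1) - 1) * tT q 1 M A j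
      + (tU q M A (j + 1) - tU q M A j) := by
  have hq : q ≠ 0 := hq0.ne'
  obtain ⟨k, hk⟩ : ∃ k : ℤ, k = (M : ℤ) + 2 - 2 * j - A := ⟨_, rfl⟩
  obtain ⟨m, hm⟩ : ∃ m : ℤ, m = j + A := ⟨_, rfl⟩
  have a1 : ((M + 2 : ℕ) : ℤ) - 2 * j - A = k := by push_cast; omega
  have a2 : ((M + 1 : ℕ) : ℤ) - 2 * j - A = k - 1 := by push_cast; omega
  have a3 : (M : ℤ) - 2 * j - A = k - 1 - 1 := by omega
  have a4 : ((M + 1 : ℕ) : ℤ) - 2 * j - (A - 1) = k := by push_cast; omega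
  have a5 : (M : ℤ) - 2 * j - (A - 1) = k - 1 := by omega
  have a6 : ((M + 1 : ℕ) : ℤ) - 2 * (j - 1) - (A + 1) = k := by push_cast; omega
  have a7 : (M : ℤ) - 2 * (j - 1) - (A + 1) = k - 1 := by omega
  have a8 : (M : ℤ) + 2 - 2 * (j + 1) - A = k - 1 - 1 := by omega
  have b1 : j + (A - 1) = m - 1 := by omega
  have b2 : j - 1 + (A + 1) = m := by omega
  have b3 : j + 1 + A - 1 = m := by omega
  have b4 : j + 1 - 1 = j := by omega
  have c1 : q ^ (j * (m - 1 - 0)) = q ^ (j * (m - 1)) := by rw [sub_zero]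
  have c2 : q ^ ((j - 1) * (m - 0)) = q ^ (j * (m - 1)) * q ^ j / q ^ m := by
    rw [← zpow_add₀ hq, ← zpow_sub₀ hq]; congr 1; ring
  have c3 : q ^ ((j + 1) * m) = q ^ (j * (m - 1)) * q ^ j * q ^ m := by
    rw [← zpow_add₀ hq, ← zpow_add₀ hq]; congr 1; ring
  have c4 : q ^ A = q ^ m / q ^ j := by rw [← zpow_sub₀ hq]; congr 1; omega
  have c5 : q ^ (k - 1) = q ^ k / q := by rw [zpow_sub₀ hq, zpow_one]
  have c6 : q ^ (k - 1 - 1) = q ^ k / q / q := by rw [zpow_sub₀ hq, c5, zpow_one]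
  have c7 : q ^ M = q ^ k * q ^ j * q ^ m / q / q := by
    rw [← zpow_natCast, ← zpow_add₀ hq, ← zpow_add₀ hq]
    have : (M : ℤ) = k + j + m - 1 - 1 := by omega
    rw [this, zpow_sub₀ hq, zpow_sub₀ hq, zpow_one]
  unfold tT tU
  rw [a1, a2, a3, a4, a5, a6, a7, a8, b1, b2, b3, b4, ← hm, ← hk, c1, c2, c3, c4, c6,
    gInv_rec q hq0 hq1 (k - 1), gInv_rec q hq0 hq1 k, gInv_rec q hq0 hq1 j,
    gInv_rec q hq0 hq1 m, c5, qPoch_succ q (M + 1), qPoch_succ q M, pow_succ q (M + 1),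
    pow_succ q M, c7]
  have hx : q ^ j ≠ 0 := zpow_ne_zero _ hq
  have hy : q ^ m ≠ 0 := zpow_ne_zero _ hq
  generalize q ^ j = x at *
  generalize q ^ m = y at *
  generalize q ^ k = z at *
  generalize q ^ (j * (m - 1)) = E at *
  field_simp
  ring

lemma qTri_rec (q : ℝ) (hq0 : 0 < q) (hq1 : q < 1) (M : ℕ) (A : ℤ) :
    qTri q 1 (M + 2) A = qTri q 0 (M + 1) (A - 1) + (q ^ (M + 1) - 1) * qTri q 0 M (A - 1)
      + q ^ A * (qTri q 0 (M + 1) (A + 1) + (q ^ (M + 1) - 1) * qTri q 0 M (A + 1))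
      + qTri q 1 (M + 1) A + q ^ M * (q ^ (M + 1) - 1) * qTri q 1 M A := by
  obtain ⟨s, hs⟩ := hasSum_tU q M A
  have hs' : HasSum (fun j => tU q M A (j + 1)) s :=
    (Equiv.addRight (1 : ℤ)).hasSum_iff.mpr hs
  have sh : ∀ L, HasSum (fun j => tT q 0 L (A + 1) (j - 1)) (qTri q 0 L (A + 1)) := fun L =>
    (Equiv.subRight (1 : ℤ)).hasSum_iff.mpr (hasSum_tT q 0 L (A + 1))
  have h := ((((((hasSum_tT q 0 (M + 1) (A - 1)).add
    ((hasSum_tT q 0 M (A - 1)).mul_left (q ^ (M + 1) - 1))).add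
    (((sh (M + 1)).add ((sh M).mul_left (q ^ (M + 1) - 1))).mul_left (q ^ A))).add
    (hasSum_tT q 1 (M + 1) A)).add
    ((hasSum_tT q 1 M A).mul_left (q ^ M * (q ^ (M + 1) - 1)))).add (hs'.sub hs))
  have h0 := hasSum_tT q 1 (M + 2) A
  rw [funext (pointwise q hq0 hq1 M A)] at h0
  rw [h0.unique h]; ring

lemma qTri_out (q : ℝ) (n : ℤ) (L : ℕ) (A : ℤ) (h : (L : ℤ) < |A|) : qTri q n L A = 0 := by
  simp [qTri, not_le.mpr h]

lemma summable_aux (p : ℤ) (hp : 4 ≤ p) (q : ℝ) (n : ℤ) (L : ℕ) (c d : ℤ) (e f : ℤ → ℝ) :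
    Summable (fun j : ℤ => e j * qTri q n L (2 * p * j + c) - f j * qTri q n L (2 * p * j + d)) := by
  apply summable_of_ne_finset_zero
    (s := Finset.Icc (-((L : ℤ) + |c| + |d|)) ((L : ℤ) + |c| + |d|))
  intro j hj
  rw [Finset.mem_Icc, ← abs_le, not_le] at hj
  have h1 : |j| ≤ |2 * p * j| := by
    rw [abs_mul]
    have : (1 : ℤ) ≤ |2 * p| := by rw [abs_of_pos] <;> linarith
    nlinarith [abs_nonneg j]
  have tri : ∀ u : ℤ, |2 * p * j| ≤ |2 * p * j + u| + |u| := fun u => by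
    have := abs_sub (2 * p * j + u) u
    rwa [add_sub_cancel_right] at this
  have hc := tri c
  have hd := tri d
  have := abs_nonneg c
  have := abs_nonneg d
  rw [qTri_out q n L _ (by linarith), qTri_out q n L _ (by linarith)]
  ring

lemma hasSum_B (p : ℤ) (hp : 4 ≤ p) (q : ℝ) (a b s : ℤ) (L : ℕ) :
    HasSum (fun j : ℤ =>
      (q ^ (p * (p + 1) * j ^ 2 + j * ((p + 1) * a - p * s)) * qTri q 0 L (2 * p * j + a - b)
      - q ^ ((p * j + a) * ((p + 1) * j + s)) * qTri q 0 L (2 * p * j + a + b)))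
      (Bpoly q p a b s L) := by
  apply Summable.hasSum
  have e1 : ∀ j, 2 * p * j + (a - b) = 2 * p * j + a - b := fun j => by ring
  have e2 : ∀ j, 2 * p * j + (a + b) = 2 * p * j + a + b := fun j => by ring
  have h := summable_aux p hp q 0 L (a - b) (a + b)
    (fun j => q ^ (p * (p + 1) * j ^ 2 + j * ((p + 1) * a - p * s)))
    (fun j => q ^ ((p * j + a) * ((p + 1) * j + s)))
  simp only [e1, e2] at h
  exact h

lemma hasSum_Bt (p : ℤ) (hp : 4 ≤ p) (q : ℝ) (a b s : ℤ) (L : ℕ) :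
    HasSum (fun j : ℤ =>
      (q ^ (p * (p + 1) * j ^ 2 + j * ((p + 1) * a - p * s)) * qTri q 1 L (2 * p * j + a - b)
      - q ^ (p * (p + 1) * j ^ 2 + j * ((p + 1) * a + p * (s - 2)) + a * (s - 1) - b)
        * qTri q 1 L (2 * p * j + a + b)))
      (Btpoly q p a b s L) := by
  apply Summable.hasSum
  have e1 : ∀ j, 2 * p * j + (a - b) = 2 * p * j + a - b := fun j => by ring
  have e2 : ∀ j, 2 * p * j + (a + b) = 2 * p * j + a + b := fun j => by ring
  have h := summable_aux p hp q 1 L (a - b) (a + b)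
    (fun j => q ^ (p * (p + 1) * j ^ 2 + j * ((p + 1) * a - p * s)))
    (fun j => q ^ (p * (p + 1) * j ^ 2 + j * ((p + 1) * a + p * (s - 2)) + a * (s - 1) - b))
  simp only [e1, e2] at h
  exact h

/-- For integers `p ≥ 4`, `1 ≤ a ≤ p-2`, `2 ≤ b ≤ p-1`, every `L ≥ 2` and `0 < q < 1`:
`B̃^p_{a,b}(L,b+2) = B^p_{a,b+1}(L-1,b+2) + (q^{L-1}-1) B^p_{a,b+1}(L-2,b+2)
  + q^{a-b} (B^p_{a,b-1}(L-1,b) + (q^{L-1}-1) B^p_{a,b-1}(L-2,b))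
  + B̃^p_{a,b}(L-1,b+2) + q^{L-2}(q^{L-1}-1) B̃^p_{a,b}(L-2,b+2)`. -/
theorem Btpoly_recurrence_general (p a b : ℤ) (hp : 4 ≤ p) (ha1 : 1 ≤ a) (ha2 : a ≤ p - 2)
    (hb1 : 2 ≤ b) (hb2 : b ≤ p - 1)
    (L : ℕ) (hL : 2 ≤ L) (q : ℝ) (hq0 : 0 < q) (hq1 : q < 1) :
    Btpoly q p a b (b + 2) L
      = Bpoly q p a (b + 1) (b + 2) (L - 1)
        + (q ^ ((L : ℤ) - 1) - 1) * Bpoly q p a (b + 1) (b + 2) (L - 2)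
        + q ^ (a - b) * (Bpoly q p a (b - 1) b (L - 1)
            + (q ^ ((L : ℤ) - 1) - 1) * Bpoly q p a (b - 1) b (L - 2))
        + Btpoly q p a b (b + 2) (L - 1)
        + q ^ ((L : ℤ) - 2) * (q ^ ((L : ℤ) - 1) - 1) * Btpoly q p a b (b + 2) (L - 2) := by
  obtain ⟨M, rfl⟩ : ∃ M, L = M + 2 := ⟨L - 2, by omega⟩
  have hq : q ≠ 0 := hq0.ne'
  have e1 : ((M + 2 : ℕ) : ℤ) - 1 = ((M + 1 : ℕ) : ℤ) := by push_cast; ring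
  have e2 : ((M + 2 : ℕ) : ℤ) - 2 = (M : ℤ) := by push_cast; ring
  rw [e1, e2, zpow_natCast, zpow_natCast, show M + 2 - 1 = M + 1 by omega,
    show M + 2 - 2 = M by omega]
  have h := (((((hasSum_B p hp q a (b + 1) (b + 2) (M + 1)).add
    ((hasSum_B p hp q a (b + 1) (b + 2) M).mul_left (q ^ (M + 1) - 1))).add
    (((hasSum_B p hp q a (b - 1) b (M + 1)).add
      ((hasSum_B p hp q a (b - 1) b M).mul_left (q ^ (M + 1) - 1))).mul_left (q ^ (a - b)))).add
    (hasSum_Bt p hp q a b (b + 2) (M + 1))).add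
    ((hasSum_Bt p hp q a b (b + 2) M).mul_left (q ^ M * (q ^ (M + 1) - 1))))
  refine (hasSum_Bt p hp q a b (b + 2) (M + 2)).unique ?_
  convert h using 1
  funext j
  rw [qTri_rec q hq0 hq1 M (2 * p * j + a - b), qTri_rec q hq0 hq1 M (2 * p * j + a + b)]
  rw [show 2 * p * j + a - (b + 1) = 2 * p * j + a - b - 1 by ring,
    show 2 * p * j + a - (b - 1) = 2 * p * j + a - b + 1 by ring,
    show 2 * p * j + a + (b + 1) = 2 * p * j + a + b + 1 by ring,
    show 2 * p * j + a + (b - 1) = 2 * p * j + a + b - 1 by ring]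
  have f1 : q ^ (a - b) * q ^ (p * (p + 1) * j ^ 2 + j * ((p + 1) * a - p * b))
      = q ^ (p * (p + 1) * j ^ 2 + j * ((p + 1) * a - p * (b + 2))) * q ^ (2 * p * j + a - b) := by
    rw [← zpow_add₀ hq, ← zpow_add₀ hq]; congr 1; ring
  have f2 : q ^ ((p * j + a) * ((p + 1) * j + (b + 2)))
      = q ^ (p * (p + 1) * j ^ 2 + j * ((p + 1) * a + p * (b + 2 - 2)) + a * (b + 2 - 1) - b)
        * q ^ (2 * p * j + a + b) := by
    rw [← zpow_add₀ hq]; congr 1; ring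
  have f3 : q ^ (a - b) * q ^ ((p * j + a) * ((p + 1) * j + b))
      = q ^ (p * (p + 1) * j ^ 2 + j * ((p + 1) * a + p * (b + 2 - 2)) + a * (b + 2 - 1) - b) := by
    rw [← zpow_add₀ hq]; congr 1; ring
  rw [f2, ← f3]
  linear_combination (-(qTri q 0 (M + 1) (2 * p * j + a - b + 1)
    + (q ^ (M + 1) - 1) * qTri q 0 M (2 * p * j + a - b + 1))) * f1
end
end

section
/- Let p ≥ 4 and 1 ≤ a ≤ p−2 be integers and let L ≥ 0. If a + δ_{a,1} is even then F^{p,0}_{a,1}(L) = q^{a(a−1)/4} B^p_{a,1}(L,1), while if a + δ_{a,1} is odd then F^{p,0}_{a,1}(L) = q^{(a−1)(a−2)/4} B^p_{a,1}(L,2), for every real q with 0 < q < 1. -/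
open Finset

noncomputable section

/-- `(q)_∞`. -/
def qPochInf (q : ℝ) : ℝ := ∏' j : ℕ, (1 - q ^ (j + 1))

/-- The matrix `Ĩ_{p-1}`. -/
def ItM (p : ℕ) (i j : Fin (p - 1)) : ℚ :=
  if i.val = 0 then (if j.val = 2 then -1 else 0)
  else if j.val = 0 then (if i.val = 2 then 1 else 0)
  else if i.val = j.val + 1 ∨ j.val = i.val + 1 then 1 else 0

/-- The matrix `C̃_{p-1} = 2·Id - Ĩ_{p-1}`. -/
def CtM (p : ℕ) (i j : Fin (p - 1)) : ℚ := (if i = j then 2 else 0) - ItM p i j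

/-- Unit vector `e_c` (zero if `c` is out of range). -/
def evec (p c : ℕ) : Fin (p - 1) → ℚ := fun i => if i.val = c then 1 else 0

/-- Kronecker delta. -/
def kdel (a b : ℕ) : ℕ := if a = b then 1 else 0

/-- `p̃(n) = 1` if `n` is odd, `0` otherwise. -/
def ptil (n : ℕ) : ℚ := if n % 2 = 1 then 1 else 0

/-- The vector `u^i_{a,b}`. -/
def uvec (p i a b : ℕ) : Fin (p - 1) → ℚ := fun j =>
  (if 1 < a then evec p a j else 0) + (if 1 < b then evec p b j else 0)
    + ptil (a + kdel a 1 + b + kdel b 1 + (if i = 1 then p - 1 else 0)) * (evec p 1 j - evec p 0 j)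

/-- The vector `A^i_{a,b}`. -/
def Avec (p i a b : ℕ) : Fin (p - 1) → ℚ := fun j =>
  (if 1 < b then evec p b j else 0)
    + ptil (a + kdel a 1 + b + kdel b 1 + (if i = 1 then p - 1 else 0)) * evec p 1 j

/-- `q`-binomial coefficient with (possibly non-integral) rational top entry:
it vanishes unless the top is an integer `N` with `0 ≤ m ≤ N`. -/
def qBinQ (q : ℝ) (N : ℚ) (m : ℕ) : ℝ :=
  if N.den = 1 ∧ (m : ℚ) ≤ N then
    qPoch q N.num.toNat / (qPoch q m * qPoch q (N.num.toNat - m))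
  else 0

/-- The quadratic form `Φ(m) = (m·C̃m)/4 - (A·m)/2`. -/
def PhiQ (p : ℕ) (A : Fin (p - 1) → ℚ) (m : Fin (p - 1) → ℕ) : ℚ :=
  (∑ i, ∑ j, (m i : ℚ) * CtM p i j * (m j : ℚ)) / 4 - (∑ j, A j * (m j : ℚ)) / 2

/-- The vector `(½ Ĩ m + L e₀ + ½ u)`. -/
def topVec (p L : ℕ) (u : Fin (p - 1) → ℚ) (m : Fin (p - 1) → ℕ) (i : Fin (p - 1)) : ℚ :=
  (∑ j, ItM p i j * (m j : ℚ)) / 2 + (L : ℚ) * evec p 0 i + u i / 2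

/-- The last component `m_{p-2}`. -/
def mlast (p : ℕ) (m : Fin (p - 1) → ℕ) : ℕ :=
  if h : p - 1 ≠ 0 then m ⟨p - 2, by omega⟩ else 0

/-- The fundamental fermionic form `f^p_k(L; u; A)`. -/
def fFerm (q : ℝ) (p k L : ℕ) (u A : Fin (p - 1) → ℚ) : ℝ :=
  ∑' m : Fin (p - 1) → ℕ,
    if mlast p m % 2 = k % 2 then
      q ^ ((PhiQ p A m : ℝ)) * ∏ i, qBinQ q (topVec p L u m i) (m i)
    else 0

/-- The fermionic polynomial `F^{p,i}_{a,b}(L)`. -/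
def Fpoly (q : ℝ) (p i a b L : ℕ) : ℝ :=
  if b = p - 1 then fFerm q p (1 - i) L (uvec p i a b) (Avec p i a b)
  else fFerm q p i L (uvec p i a b) (Avec p i a b)

def phiR (a b : ℝ) : ℝ := (b - a) * (b - a + 1) / 4

def phitR (a b : ℝ) : ℝ := (b - a) * (b - a + 3) / 4

/-- Virasoro character `χ^{p,p+1}_{r,s}(q)` of the minimal model `M(p,p+1)`. -/
def chiV (p r s : ℤ) (q : ℝ) : ℝ :=
  (∑' j : ℤ, (q ^ (p * (p + 1) * j ^ 2 + j * ((p + 1) * r - p * s))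
      - q ^ ((p * j + r) * ((p + 1) * j + s)))) / qPochInf q


/-! q-binomials with integer arguments -/

/-- Reciprocal of `(q)_k`, zero for negative `k`. -/
def rp (q : ℝ) (k : ℤ) : ℝ := if 0 ≤ k then (qPoch q k.toNat)⁻¹ else 0

/-- `(q)_k` for integer `k`. -/
def qp (q : ℝ) (k : ℤ) : ℝ := qPoch q k.toNat

/-- `q`-binomial with integer arguments and the zero convention. -/
def qb (q : ℝ) (N k : ℤ) : ℝ := qp q N * rp q k * rp q (N - k)

lemma one_sub_qpow_pos {q : ℝ} (hq0 : 0 < q) (hq1 : q < 1) (k : ℕ) (hk : k ≠ 0) :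
    0 < 1 - q ^ k := by
  have := pow_lt_one₀ hq0.le hq1 hk
  linarith

lemma qPoch_pos {q : ℝ} (hq0 : 0 < q) (hq1 : q < 1) (k : ℕ) : 0 < qPoch q k :=
  Finset.prod_pos fun j _ => one_sub_qpow_pos hq0 hq1 (j + 1) (by omega)

lemma rp_neg {q : ℝ} {k : ℤ} (hk : k < 0) : rp q k = 0 := by
  simp [rp, not_le.mpr hk]

lemma rp_nonneg {q : ℝ} (hq0 : 0 < q) (hq1 : q < 1) (k : ℤ) : 0 ≤ rp q k := by
  unfold rp; split_ifs
  · exact inv_nonneg.mpr (qPoch_pos hq0 hq1 _).le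
  · exact le_rfl

lemma qp_pos {q : ℝ} (hq0 : 0 < q) (hq1 : q < 1) (k : ℤ) : 0 < qp q k := qPoch_pos hq0 hq1 _

lemma rp_zero (q : ℝ) : rp q 0 = 1 := by simp [rp, qPoch]

lemma qp_zero (q : ℝ) : qp q 0 = 1 := by simp [qp, qPoch]

lemma rp_pred {q : ℝ} (hq0 : 0 < q) (hq1 : q < 1) (k : ℤ) :
    rp q (k - 1) = (1 - q ^ k) * rp q k := by
  rcases lt_trichotomy k 0 with h | h | h
  · rw [rp_neg h, rp_neg (by omega)]; simp
  · subst h; rw [rp_neg (by omega)]; simp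
  · obtain ⟨n, rfl⟩ : ∃ n : ℕ, k = n + 1 := ⟨(k - 1).toNat, by omega⟩
    have e1 : ((n : ℤ) + 1 - 1) = n := by ring
    have h1 := (qPoch_pos hq0 hq1 n).ne'
    have h2 := (one_sub_qpow_pos hq0 hq1 (n + 1) (by omega)).ne'
    have e2 : ((n : ℤ) + 1).toNat = n + 1 := by omega
    rw [e1]
    simp only [rp, e2, qPoch_succ]
    have e3 : q ^ ((n : ℤ) + 1) = q ^ (n + 1) := by
      rw [← zpow_natCast]; push_cast; rfl
    rw [e3, if_pos (by omega), if_pos (by omega)]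
    simp only [Int.toNat_natCast]
    field_simp

lemma qp_succ {q : ℝ} (k : ℤ) (hk : 0 ≤ k) :
    qp q (k + 1) = qp q k * (1 - q ^ (k + 1)) := by
  obtain ⟨n, rfl⟩ := Int.eq_ofNat_of_zero_le hk
  have e3 : q ^ ((n : ℤ) + 1) = q ^ (n + 1) := by
    rw [← zpow_natCast]; push_cast; rfl
  have e2 : ((n : ℤ) + 1).toNat = n + 1 := by omega
  simp only [qp, e2, qPoch_succ, Int.toNat_natCast, e3]

lemma qp_mul_rp {q : ℝ} (hq0 : 0 < q) (hq1 : q < 1) (k : ℤ) (hk : 0 ≤ k) :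
    qp q k * rp q k = 1 := by
  simp only [qp, rp, if_pos hk]
  exact mul_inv_cancel₀ (qPoch_pos hq0 hq1 _).ne'

lemma qb_neg_right {q : ℝ} {N k : ℤ} (hk : k < 0) : qb q N k = 0 := by
  simp [qb, rp_neg hk]

lemma qb_gt {q : ℝ} {N k : ℤ} (hk : N < k) : qb q N k = 0 := by
  simp [qb, rp_neg (show N - k < 0 by omega)]

lemma qb_ne {q : ℝ} {N k : ℤ} (h : qb q N k ≠ 0) : 0 ≤ k ∧ k ≤ N := by
  constructor
  · by_contra hk; exact h (qb_neg_right (by omega))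
  · by_contra hk; exact h (qb_gt (by omega))

lemma qb_nonneg {q : ℝ} (hq0 : 0 < q) (hq1 : q < 1) (N k : ℤ) : 0 ≤ qb q N k :=
  mul_nonneg (mul_nonneg (qp_pos hq0 hq1 N).le (rp_nonneg hq0 hq1 _)) (rp_nonneg hq0 hq1 _)

lemma qb_symm (q : ℝ) (N k : ℤ) : qb q N (N - k) = qb q N k := by
  simp only [qb, sub_sub_cancel]; ring

lemma qb_zero {q : ℝ} (hq0 : 0 < q) (hq1 : q < 1) {N : ℤ} (hN : 0 ≤ N) : qb q N 0 = 1 := by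
  simp [qb, rp_zero, qp_mul_rp hq0 hq1 N hN]

/-- Pascal rule. -/
lemma qb_pascal1 {q : ℝ} (hq0 : 0 < q) (hq1 : q < 1) (N k : ℤ) (hN : 0 ≤ N) :
    qb q (N + 1) k = qb q N k + q ^ (N + 1 - k) * qb q N (k - 1) := by
  unfold qb
  rw [qp_succ N hN, rp_pred hq0 hq1 k,
    show N - k = (N + 1 - k) - 1 by ring, rp_pred hq0 hq1 (N + 1 - k),
    show N - (k - 1) = N + 1 - k by ring]
  have : q ^ (N + 1) = q ^ (N + 1 - k) * q ^ k := by
    rw [← zpow_add₀ hq0.ne']; congr 1; ring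
  rw [this]; ring

lemma qb_pascal2 {q : ℝ} (hq0 : 0 < q) (hq1 : q < 1) (N k : ℤ) (hN : 0 ≤ N) :
    qb q (N + 1) k = qb q N (k - 1) + q ^ k * qb q N k := by
  unfold qb
  rw [qp_succ N hN, rp_pred hq0 hq1 k,
    show N - k = (N + 1 - k) - 1 by ring, rp_pred hq0 hq1 (N + 1 - k),
    show N - (k - 1) = N + 1 - k by ring]
  have : q ^ (N + 1) = q ^ (N + 1 - k) * q ^ k := by
    rw [← zpow_add₀ hq0.ne']; congr 1; ring
  rw [this]; ring

/-- q-Vandermonde. -/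
lemma qvand {q : ℝ} (hq0 : 0 < q) (hq1 : q < 1) (A B : ℕ) (D : ℤ) :
    ∑ t ∈ range (A + 1), q ^ ((t : ℤ) * (t + D)) * qb q A t * qb q B (t + D)
      = qb q (A + B) (A + D) := by
  induction A generalizing D with
  | zero => simp [qb_zero hq0 hq1]
  | succ A ih =>
    have e : ∀ t : ℕ, q ^ ((t : ℤ) * (t + D)) * qb q ((A + 1 : ℕ) : ℤ) t * qb q B (t + D)
        = q ^ ((t : ℤ) * (t + D)) * qb q A t * qb q B (t + D)
        + q ^ ((t : ℤ) * (t + D)) * q ^ ((A : ℤ) + 1 - t) * qb q A (t - 1) * qb q B (t + D) := by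
      intro t
      push_cast
      rw [qb_pascal1 hq0 hq1 A t (by omega)]; ring
    rw [Finset.sum_congr rfl fun t _ => e t, Finset.sum_add_distrib]
    rw [Finset.sum_range_succ, ih D, Finset.sum_range_succ']
    have e2 : ∀ t : ℕ, q ^ (((t + 1 : ℕ) : ℤ) * (((t + 1 : ℕ) : ℤ) + D))
          * q ^ ((A : ℤ) + 1 - ((t + 1 : ℕ) : ℤ)) * qb q A (((t + 1 : ℕ) : ℤ) - 1)
          * qb q B (((t + 1 : ℕ) : ℤ) + D)
        = q ^ ((A : ℤ) + D + 1) *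
          (q ^ ((t : ℤ) * (t + (D + 1))) * qb q A t * qb q B (t + (D + 1))) := by
      intro t
      push_cast
      rw [show (t : ℤ) + 1 - 1 = t by ring, show (t : ℤ) + 1 + D = t + (D + 1) by ring,
        ← zpow_add₀ hq0.ne', ← mul_assoc, ← mul_assoc, ← zpow_add₀ hq0.ne']
      congr 3; ring
    rw [Finset.sum_congr rfl fun t _ => e2 t, ← Finset.mul_sum, ih (D + 1)]
    rw [qb_gt (N := (A : ℤ)) (k := ((A + 1 : ℕ) : ℤ)) (by push_cast; omega),
      qb_neg_right (N := (A : ℤ)) (k := ((0 : ℕ) : ℤ) - 1) (by norm_num)]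
    push_cast
    rw [show (A : ℤ) + 1 + B = (A + B) + 1 by ring, qb_pascal2 hq0 hq1 _ _ (by omega),
      show (A : ℤ) + 1 + D - 1 = A + D by ring, show (A : ℤ) + (D + 1) = A + 1 + D by ring,
      show (A : ℤ) + D + 1 = A + 1 + D by ring]
    ring

/-- Summand of the q-Saalschütz sum. -/
def saF (q : ℝ) (A B D M : ℤ) (t : ℤ) : ℝ :=
  q ^ (t * (t + D)) * qb q A t * qb q B (t + D) * qb q (A + B + M - t) (A + B)

/-- Telescoping certificate for the q-Saalschütz sum. -/
def saG (q : ℝ) (A B D M : ℤ) (t : ℤ) : ℝ :=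
  q ^ (t * (t + D) - t + A + 1) * qp q A * rp q (t - 1) * rp q (A + 1 - t) *
    (qp q B * rp q (t + D - 1) * rp q (B - t - D)) *
    (qp q (A + B + M + 1 - t) * rp q (A + B + 1) * rp q (M - t))

lemma sa_tele {q : ℝ} (hq0 : 0 < q) (hq1 : q < 1) (A B D M t : ℤ) (hA : 0 ≤ A) (hB : 0 ≤ B) :
    (1 - q ^ (A + 1 + D)) * saF q (A + 1) B D M t
      - (1 - q ^ (A + 1 + M + D)) * saF q A B D M t
      = saG q A B D M t - saG q A B D M (t + 1) := by
  by_cases htM : M < t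
  · have h1 : rp q (M - t) = 0 := rp_neg (by omega)
    have h2 : rp q (M - (t + 1)) = 0 := rp_neg (by omega)
    simp only [saF, saG, h2, h1]
    rw [qb_gt (N := A + 1 + B + M - t) (by omega), qb_gt (N := A + B + M - t) (by omega)]
    ring
  have hne := hq0.ne'
  unfold saF saG qb
  rw [qp_succ A hA, show A + 1 + B + M - t = (A + B + M - t) + 1 by ring,
    show A + B + M + 1 - t = (A + B + M - t) + 1 by ring,
    show A + B + M + 1 - (t + 1) = (A + B + M - t) by ring,
    qp_succ (A + B + M - t) (by omega), show (A + B + M - t) + 1 - (A + 1 + B) = M - t by ring,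
    show (A + B + M - t) - (A + B) = M - t by ring, show M - (t + 1) = M - t - 1 by ring,
    rp_pred hq0 hq1 (M - t), show A + 1 + B = A + B + 1 by ring,
    show rp q (A + B) = (1 - q ^ (A + B + 1)) * rp q (A + B + 1) by
      rw [← rp_pred hq0 hq1]; congr 1; ring,
    show t + 1 - 1 = t by ring, show t + 1 + D - 1 = t + D by ring,
    rp_pred hq0 hq1 t, rp_pred hq0 hq1 (t + D),
    show A - t = A + 1 - t - 1 by ring, show A + 1 - (t + 1) = A + 1 - t - 1 by ring,
    rp_pred hq0 hq1 (A + 1 - t), show B - (t + D) = B - t - D by ring,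
    show B - (t + 1) - D = B - t - D - 1 by ring, rp_pred hq0 hq1 (B - t - D)]
  have e1 : q ^ ((t + 1) * (t + 1 + D) - (t + 1) + A + 1)
      = q ^ (t * (t + D)) * (q ^ t * q ^ D * q ^ A * q) := by
    rw [show (t + 1) * (t + 1 + D) - (t + 1) + A + 1 = t * (t + D) + (t + D + A + 1) by ring]
    simp only [zpow_add₀ hne, zpow_one]
  have e2 : q ^ (t * (t + D) - t + A + 1) = q ^ (t * (t + D)) * ((q ^ t)⁻¹ * q ^ A * q) := by
    rw [show t * (t + D) - t + A + 1 = t * (t + D) + (-t + A + 1) by ring]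
    simp only [zpow_add₀ hne, zpow_one, zpow_neg]
  rw [e1, e2]
  simp only [zpow_add₀ hne, zpow_one, zpow_sub₀ hne]
  have hx : q ^ t ≠ 0 := zpow_ne_zero _ hne
  have hd : q ^ D ≠ 0 := zpow_ne_zero _ hne
  field_simp
  ring

/-- q-Saalschütz in the Burge form. -/
lemma qsaal {q : ℝ} (hq0 : 0 < q) (hq1 : q < 1) (A B D M : ℕ) :
    ∑ t ∈ range (A + 1), saF q A B D M t
      = qb q (A + M + D) (A + D) * qb q (B + M) (B - D) := by
  induction A with
  | zero =>
    simp only [zero_add, Finset.sum_range_one, saF]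
    simp only [CharP.cast_eq_zero, zero_mul, zpow_zero, one_mul, zero_add, sub_zero]
    rw [qb_zero hq0 hq1 le_rfl]
    unfold qb
    have h1 := qp_mul_rp hq0 hq1 (B : ℤ) (by omega)
    have h2 := qp_mul_rp hq0 hq1 ((M : ℤ) + D) (by omega)
    rw [show (B : ℤ) + M - B = M by ring, show (M : ℤ) + D - D = M by ring,
      show (B : ℤ) + M - (B - D) = M + D by ring]
    linear_combination (rp q D * rp q (B - D) * qp q (B + M) * rp q M) * (h1 - h2)
  | succ A ih =>
    have hs : (1 - q ^ ((A : ℤ) + 1 + D)) * ∑ t ∈ range (A + 1 + 1), saF q ((A + 1 : ℕ) : ℤ) B D M t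
        - (1 - q ^ ((A : ℤ) + 1 + M + D)) * ∑ t ∈ range (A + 1 + 1), saF q A B D M t
        = saG q A B D M ((0 : ℕ) : ℤ) - saG q A B D M ((A + 1 + 1 : ℕ) : ℤ) := by
      rw [← Finset.sum_range_sub' (fun t : ℕ => saG q A B D M (t : ℤ)),
        Finset.mul_sum, Finset.mul_sum, ← Finset.sum_sub_distrib]
      refine Finset.sum_congr rfl fun t _ => ?_
      have := sa_tele hq0 hq1 A B D M t (by omega) (by omega)
      push_cast
      exact this
    have g0 : saG q A B D M ((0 : ℕ) : ℤ) = 0 := by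
      simp [saG, rp_neg (q := q) (show (-1 : ℤ) < 0 by norm_num)]
    have g1 : saG q A B D M ((A + 1 + 1 : ℕ) : ℤ) = 0 := by
      simp [saG, rp_neg (q := q) (show (-1 : ℤ) < 0 by norm_num)]
    have l0 : saF q A B D M ((A + 1 : ℕ) : ℤ) = 0 := by
      unfold saF; rw [qb_gt (N := (A : ℤ)) (by push_cast; omega)]; ring
    rw [Finset.sum_range_succ (fun t : ℕ => saF q A B D M t), ih, l0, g0, g1] at hs
    have hpos : (1 - q ^ ((A : ℤ) + 1 + D)) ≠ 0 := by
      have := (one_sub_qpow_pos hq0 hq1 (A + 1 + D) (by omega)).ne'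
      rw [← zpow_natCast] at this; push_cast at this; exact this
    apply mul_left_cancel₀ hpos
    have hr : (1 - q ^ ((A : ℤ) + 1 + D)) * qb q (((A + 1 : ℕ) : ℤ) + M + D) (((A + 1 : ℕ) : ℤ) + D)
        = (1 - q ^ ((A : ℤ) + 1 + M + D)) * qb q (A + M + D) (A + D) := by
      unfold qb
      push_cast
      rw [show (A : ℤ) + 1 + M + D = (A + M + D) + 1 by ring, qp_succ _ (by omega),
        show rp q ((A : ℤ) + D) = (1 - q ^ ((A : ℤ) + 1 + D)) * rp q ((A : ℤ) + 1 + D) by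
          rw [← rp_pred hq0 hq1]; congr 1; ring,
        show (A : ℤ) + M + D + 1 - (A + 1 + D) = M by ring,
        show (A : ℤ) + M + D - (A + D) = M by ring]
      ring
    linear_combination hs - hr * qb q (B + M) (B - D)


/-- Parity guarded `q`-binomial `[x/2 choose y/2]`. -/
def qb2 (q : ℝ) (x y : ℤ) : ℝ := if x % 2 = 0 ∧ y % 2 = 0 then qb q (x / 2) (y / 2) else 0

lemma qb2_two (q : ℝ) (x y : ℤ) : qb2 q (2 * x) (2 * y) = qb q x y := by
  unfold qb2
  rw [if_pos (by omega)]
  congr 1 <;> omega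

lemma qb2_eq {q : ℝ} {x y : ℤ} (X Y : ℤ) (hx : x = 2 * X) (hy : y = 2 * Y) :
    qb2 q x y = qb q X Y := by
  subst hx hy; exact qb2_two q X Y

lemma qb2_ne {q : ℝ} {x y : ℤ} (h : qb2 q x y ≠ 0) :
    x % 2 = 0 ∧ y % 2 = 0 ∧ 0 ≤ y ∧ y ≤ x := by
  unfold qb2 at h
  split_ifs at h with hc
  · have := qb_ne h; omega
  · exact absurd rfl h

lemma qb2_nonneg {q : ℝ} (hq0 : 0 < q) (hq1 : q < 1) (x y : ℤ) : 0 ≤ qb2 q x y := by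
  unfold qb2; split_ifs
  · exact qb_nonneg hq0 hq1 _ _
  · exact le_rfl

/-- The product of two `q`-binomials occurring in the Burge transform. -/
def Bq (q : ℝ) (s n C D : ℤ) : ℝ := qb2 q (s + C - D) (n + C) * qb2 q (s - C + D) (n - C)

lemma Bq_neg (q : ℝ) (s n C D : ℤ) : Bq q s n (-C) (-D) = Bq q s n C D := by
  unfold Bq
  rw [mul_comm]
  congr 2 <;> ring

lemma Bq_ne {q : ℝ} {s n C D : ℤ} (h : Bq q s n C D ≠ 0) :
    (s + C - D) % 2 = 0 ∧ (n + C) % 2 = 0 ∧ 0 ≤ n + C ∧ 0 ≤ n - C ∧ n + C ≤ s + C - D ∧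
      n - C ≤ s - C + D := by
  have h1 := qb2_ne (left_ne_zero_of_mul h)
  have h2 := qb2_ne (right_ne_zero_of_mul h)
  omega

lemma sum_reindex (f g : ℕ → ℝ) (n A : ℕ) (c : ℤ)
    (h1 : ∀ n1 : ℕ, f n1 ≠ 0 → ∃ t : ℕ, t < A + 1 ∧ (n1 : ℤ) = c - 2 * t)
    (h2 : ∀ t : ℕ, t < A + 1 → g t ≠ 0 → ∃ n1 : ℕ, n1 < n + 1 ∧ (n1 : ℤ) = c - 2 * t)
    (h3 : ∀ n1 t : ℕ, (n1 : ℤ) = c - 2 * t → f n1 = g t) :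
    ∑ n1 ∈ range (n + 1), f n1 = ∑ t ∈ range (A + 1), g t := by
  refine Finset.sum_bij_ne_zero (fun n1 _ _ => ((c - n1) / 2).toNat) ?_ ?_ ?_ ?_
  · intro n1 _ hf
    obtain ⟨t, ht, e⟩ := h1 n1 hf
    simp only [Finset.mem_range]; omega
  · intro a _ ha b _ hb hab
    obtain ⟨t, ht, e⟩ := h1 a ha
    obtain ⟨t', ht', e'⟩ := h1 b hb
    omega
  · intro t ht hg
    rw [Finset.mem_range] at ht
    obtain ⟨n1, hn, e⟩ := h2 t ht hg
    refine ⟨n1, Finset.mem_range.mpr hn, ?_, by omega⟩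
    rw [h3 n1 t e]; exact hg
  · intro n1 _ hf
    obtain ⟨t, ht, e⟩ := h1 n1 hf
    rw [h3 n1 t e]
    congr 1; omega

lemma q_zpow {q h : ℝ} (hh : q = h ^ 4) (z : ℤ) : q ^ z = h ^ (4 * z) := by
  rw [hh, ← zpow_natCast, ← zpow_mul]; rfl

lemma burge_pos {q h : ℝ} (hq0 : 0 < q) (hq1 : q < 1) (hh0 : 0 < h) (hh : q = h ^ 4)
    (s n : ℕ) (C D : ℤ) (hD : 0 ≤ D) (hCD : 0 ≤ C * D) :
    ∑ n1 ∈ range (n + 1), h ^ (((n : ℤ) - n1) ^ 2) * qb2 q (s + n1) (2 * n) * Bq q n n1 C D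
      = h ^ (D ^ 2) * Bq q s n (C + D) D := by
  have hCD' : D = 0 ∨ 0 ≤ C := by
    rcases hD.eq_or_lt with h | h
    · exact Or.inl h.symm
    · exact Or.inr (nonneg_of_mul_nonneg_left hCD h)
  by_cases hz : ((n : ℤ) + C + D) % 2 = 0 ∧ ((s : ℤ) + C) % 2 = 0 ∧ 0 ≤ (n : ℤ) + C - D ∧
      0 ≤ (n : ℤ) - C + D ∧ 0 ≤ (s : ℤ) - n - D
  · obtain ⟨p1, p2, p3, p4, p5⟩ := hz
    obtain ⟨A, hA⟩ : ∃ A : ℕ, (n : ℤ) + C - D = 2 * A := ⟨(((n : ℤ) + C - D) / 2).toNat, by omega⟩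
    obtain ⟨B, hB⟩ : ∃ B : ℕ, (n : ℤ) - C + D = 2 * B := ⟨(((n : ℤ) - C + D) / 2).toNat, by omega⟩
    obtain ⟨M, hM⟩ : ∃ M : ℕ, (s : ℤ) - n - D = 2 * M := ⟨(((s : ℤ) - n - D) / 2).toNat, by omega⟩
    obtain ⟨d, rfl⟩ := Int.eq_ofNat_of_zero_le hD
    rw [sum_reindex _ (fun t => h ^ ((d : ℤ) ^ 2) * saF q A B d M t) n A (n - d)]
    · rw [← Finset.mul_sum, qsaal hq0 hq1]
      congr 1
      unfold Bq
      congr 1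
      · exact (qb2_eq _ _ (by omega) (by omega)).symm
      · exact (qb2_eq _ _ (by omega) (by omega)).symm
    · intro n1 hf
      have := Bq_ne (right_ne_zero_of_mul hf)
      exact ⟨(((n : ℤ) - d - n1) / 2).toNat, by omega, by omega⟩
    · intro t ht hg
      have hg' := right_ne_zero_of_mul hg
      unfold saF at hg'
      have k1 := qb_ne (right_ne_zero_of_mul (left_ne_zero_of_mul hg'))
      have k2 := qb_ne (right_ne_zero_of_mul (left_ne_zero_of_mul (left_ne_zero_of_mul hg')))
      exact ⟨((n : ℤ) - d - 2 * t).toNat, by omega, by omega⟩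
    · intro n1 t e
      unfold Bq saF
      rw [qb2_eq (x := (n : ℤ) + C - d) A (A - t) (by omega) (by omega),
        qb2_eq (x := (n : ℤ) - C + d) B (B - (t + d)) (by omega) (by omega),
        qb2_eq (x := (s : ℤ) + n1) (A + B + M - t) (A + B) (by omega) (by omega),
        qb_symm, qb_symm, q_zpow hh, show ((n : ℤ) - n1) = d + 2 * t by omega,
        show ((d : ℤ) + 2 * t) ^ 2 = d ^ 2 + 4 * (t * (t + d)) by ring, zpow_add₀ hh0.ne']
      ring
  · have hr : Bq q s n (C + D) D = 0 := by
      by_contra hne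
      have := Bq_ne hne
      omega
    rw [hr, mul_zero]
    refine Finset.sum_eq_zero fun n1 _ => ?_
    by_contra hne
    have k1 := Bq_ne (right_ne_zero_of_mul hne)
    have k2 := qb2_ne (right_ne_zero_of_mul (left_ne_zero_of_mul hne))
    omega

/-- The Burge transform. -/
lemma burge {q h : ℝ} (hq0 : 0 < q) (hq1 : q < 1) (hh0 : 0 < h) (hh : q = h ^ 4)
    (s n : ℕ) (C D : ℤ) (hCD : 0 ≤ C * D) :
    ∑ n1 ∈ range (n + 1), h ^ (((n : ℤ) - n1) ^ 2) * qb2 q (s + n1) (2 * n) * Bq q n n1 C D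
      = h ^ (D ^ 2) * Bq q s n (C + D) D := by
  rcases le_total 0 D with hD | hD
  · exact burge_pos hq0 hq1 hh0 hh s n C D hD hCD
  · have := burge_pos hq0 hq1 hh0 hh s n (-C) (-D) (by omega) (by linarith [neg_mul_neg C D])
    rw [show -C + -D = -(C + D) by ring, Bq_neg, neg_sq] at this
    simp only [Bq_neg] at this
    exact this

/-- The limiting Burge transform. -/
lemma burge_inf {q h : ℝ} (hq0 : 0 < q) (hq1 : q < 1) (hh0 : 0 < h) (hh : q = h ^ 4)
    (n : ℕ) (C D : ℤ) (hCD : 0 ≤ C * D) :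
    ∑ n1 ∈ range (n + 1), h ^ (((n : ℤ) - n1) ^ 2) * Bq q n n1 C D
      = h ^ (D ^ 2) * qb2 q (2 * n) (n - (C + D)) := by
  have hCD' : (0 ≤ C ∧ 0 ≤ D) ∨ (C ≤ 0 ∧ D ≤ 0) := mul_nonneg_iff.mp hCD
  by_cases hz : ((n : ℤ) + C + D) % 2 = 0 ∧ 0 ≤ (n : ℤ) + C - D ∧ 0 ≤ (n : ℤ) - C + D
  · obtain ⟨p1, p3, p4⟩ := hz
    obtain ⟨A, hA⟩ : ∃ A : ℕ, (n : ℤ) + C - D = 2 * A := ⟨(((n : ℤ) + C - D) / 2).toNat, by omega⟩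
    obtain ⟨B, hB⟩ : ∃ B : ℕ, (n : ℤ) - C + D = 2 * B := ⟨(((n : ℤ) - C + D) / 2).toNat, by omega⟩
    rw [sum_reindex _ (fun t => h ^ (D ^ 2) *
      (q ^ ((t : ℤ) * (t + D)) * qb q A t * qb q B (t + D))) n A (n - D)]
    · rw [← Finset.mul_sum, qvand hq0 hq1]
      congr 1
      rw [qb2_eq (A + B) (A + B - (A + D)) (by omega) (by omega), qb_symm]
    · intro n1 hf
      have := Bq_ne (right_ne_zero_of_mul hf)
      exact ⟨(((n : ℤ) - D - n1) / 2).toNat, by omega, by omega⟩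
    · intro t ht hg
      have hg' := right_ne_zero_of_mul hg
      have k1 := qb_ne (right_ne_zero_of_mul hg')
      have k2 := qb_ne (right_ne_zero_of_mul (left_ne_zero_of_mul hg'))
      exact ⟨((n : ℤ) - D - 2 * t).toNat, by omega, by omega⟩
    · intro n1 t e
      unfold Bq
      rw [qb2_eq (x := (n : ℤ) + C - D) A (A - t) (by omega) (by omega),
        qb2_eq (x := (n : ℤ) - C + D) B (B - (t + D)) (by omega) (by omega),
        qb_symm, qb_symm, q_zpow hh, show ((n : ℤ) - n1) = D + 2 * t by omega,
        show (D + 2 * t) ^ 2 = D ^ 2 + 4 * (t * (t + D)) by ring, zpow_add₀ hh0.ne']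
      ring
  · have hr : qb2 q (2 * n) (n - (C + D)) = 0 := by
      by_contra hne
      have := qb2_ne hne
      omega
    rw [hr, mul_zero]
    refine Finset.sum_eq_zero fun n1 _ => ?_
    by_contra hne
    have k1 := Bq_ne (right_ne_zero_of_mul hne)
    omega


/-- Summand of the doubly bounded bosonic form. -/
def Et (q h : ℝ) (K s n r : ℤ) : ℝ :=
  h ^ (4 * (K * r ^ 2 - r)) * Bq q s n (2 * K * r) (2 * r)
    - h ^ (4 * (K * r ^ 2 + r)) * Bq q s n (2 * K * r + 2) (2 * r)

/-- Summand of the doubly bounded bosonic form after a source. -/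
def Est (q h : ℝ) (K m s n r : ℤ) : ℝ :=
  h ^ (4 * (K * r ^ 2 - r) + m * (2 * r - 1) ^ 2)
      * Bq q s n (2 * K * r + m * (2 * r - 1)) (2 * r - 1)
    - h ^ (4 * (K * r ^ 2 + r) + m * (2 * r + 1) ^ 2)
      * Bq q s n (2 * K * r + 2 + m * (2 * r + 1)) (2 * r + 1)

lemma sum_Icc_range (f : ℤ → ℝ) (R : ℕ) :
    ∑ r ∈ Icc (-(R : ℤ)) R, f r = ∑ i ∈ range (2 * R + 1), f ((i : ℤ) - R) := by
  refine Finset.sum_nbij' (fun r => (r + R).toNat) (fun i => (i : ℤ) - R) ?_ ?_ ?_ ?_ ?_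
  · intro r hr; rw [Finset.mem_Icc] at hr; rw [Finset.mem_range]; omega
  · intro r hr; rw [Finset.mem_range] at hr; rw [Finset.mem_Icc]; omega
  · intro r hr; rw [Finset.mem_Icc] at hr; omega
  · intro r hr; omega
  · intro r hr; rw [Finset.mem_Icc] at hr; congr 1; omega

lemma sum_Icc_tele (f : ℤ → ℝ) (R : ℕ) :
    ∑ r ∈ Icc (-(R : ℤ)) R, (f (r + 1) - f r) = f (R + 1) - f (-R) := by
  rw [sum_Icc_range]
  have := Finset.sum_range_sub (fun i : ℕ => f ((i : ℤ) - R)) (2 * R + 1)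
  rw [show f ((R : ℤ) + 1) = f (((2 * R + 1 : ℕ) : ℤ) - R) by congr 1; push_cast; ring,
    show f (-(R : ℤ)) = f (((0 : ℕ) : ℤ) - R) by congr 1; simp, ← this]
  refine Finset.sum_congr rfl fun i _ => ?_
  congr 2; push_cast; ring

lemma E_base {q h : ℝ} (hq0 : 0 < q) (hq1 : q < 1) (hh0 : 0 < h) (hh : q = h ^ 4)
    (s n R : ℕ) (hR : n + 2 ≤ R) :
    ∑ r ∈ Icc (-(R : ℤ)) R, Et q h 1 s n r = if s = 0 ∧ n = 0 then 1 else 0 := by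
  by_cases hpar : (s : ℤ) % 2 = 0 ∧ (n : ℤ) % 2 = 0
  swap
  · rw [if_neg (by omega)]
    refine Finset.sum_eq_zero fun r _ => ?_
    unfold Et
    have h1 : Bq q s n (2 * 1 * r) (2 * r) = 0 := by
      by_contra hne; have := Bq_ne hne; omega
    have h2 : Bq q s n (2 * 1 * r + 2) (2 * r) = 0 := by
      by_contra hne; have := Bq_ne hne; omega
    rw [h1, h2]; ring
  obtain ⟨S, rfl⟩ : ∃ S : ℕ, s = 2 * S := ⟨s / 2, by omega⟩
  obtain ⟨v, rfl⟩ : ∃ v : ℕ, n = 2 * v := ⟨n / 2, by omega⟩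
  rcases Nat.eq_zero_or_pos S with hS | hS
  · subst hS
    have h2 : ∀ r : ℤ, Bq q ((2 * 0 : ℕ) : ℤ) ((2 * v : ℕ) : ℤ) (2 * 1 * r + 2) (2 * r) = 0 := by
      intro r
      by_contra hne; have := Bq_ne hne; push_cast at this; omega
    rw [Finset.sum_eq_single (0 : ℤ)]
    · unfold Et
      rw [h2]
      by_cases hv : v = 0
      · subst hv
        simp [Bq, qb2, qb_zero hq0 hq1]
      · rw [if_neg (by omega)]
        have : Bq q ((2 * 0 : ℕ) : ℤ) ((2 * v : ℕ) : ℤ) (2 * 1 * 0) (2 * 0) = 0 := by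
          by_contra hne; have := Bq_ne hne; push_cast at this; omega
        rw [this]; ring
    · intro r _ hr
      unfold Et
      rw [h2]
      have : Bq q ((2 * 0 : ℕ) : ℤ) ((2 * v : ℕ) : ℤ) (2 * 1 * r) (2 * r) = 0 := by
        by_contra hne; have := Bq_ne hne; push_cast at this; omega
      rw [this]; ring
    · intro hmem; exact absurd (Finset.mem_Icc.mpr (by omega)) hmem
  · rw [if_neg (by omega)]
    obtain ⟨f, hf⟩ : ∃ f : ℤ → ℝ, f = fun r : ℤ =>
        q ^ ((S : ℤ) - v + (r - 1) ^ 2) * qb q S (v + r - 1) * qb q (S - 1) (v - r)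
          - q ^ (r ^ 2 - r) * qb q (S + 1) (v + r) * qb q (S - 1) (v - r) := ⟨_, rfl⟩
    have key : ∀ r : ℤ, Et q h 1 ((2 * S : ℕ) : ℤ) ((2 * v : ℕ) : ℤ) r = f (r + 1) - f r := by
      intro r
      have pa := qb_pascal1 hq0 hq1 S (v + r) (by omega)
      have pb := qb_pascal1 hq0 hq1 (S - 1) (v - r) (by omega)
      have e1 : Bq q ((2 * S : ℕ) : ℤ) ((2 * v : ℕ) : ℤ) (2 * 1 * r) (2 * r)
          = qb q S (v + r) * qb q S (v - r) := by
        unfold Bq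
        rw [qb2_eq S (v + r) (by push_cast; ring) (by push_cast; ring),
          qb2_eq S (v - r) (by push_cast; ring) (by push_cast; ring)]
      have e2 : Bq q ((2 * S : ℕ) : ℤ) ((2 * v : ℕ) : ℤ) (2 * 1 * r + 2) (2 * r)
          = qb q (S + 1) (v + (r + 1)) * qb q (S - 1) (v - (r + 1)) := by
        unfold Bq
        rw [qb2_eq (S + 1) (v + (r + 1)) (by push_cast; ring) (by push_cast; ring),
          qb2_eq (S - 1) (v - (r + 1)) (by push_cast; ring) (by push_cast; ring)]
      unfold Et
      rw [e1, e2, ← q_zpow hh, ← q_zpow hh]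
      simp only [hf]
      rw [show (S : ℤ) - 1 + 1 = S by ring] at pb
      have x1 : q ^ ((S : ℤ) - v + r ^ 2) = q ^ (1 * r ^ 2 - r) * q ^ ((S : ℤ) - (v - r)) := by
        rw [← zpow_add₀ hq0.ne']; congr 1; ring
      have x2 : q ^ ((S : ℤ) - v + (r - 1) ^ 2)
          = q ^ (1 * r ^ 2 - r) * q ^ ((S : ℤ) + 1 - (v + r)) := by
        rw [← zpow_add₀ hq0.ne']; congr 1; ring
      rw [pa, pb, show (v : ℤ) + (r + 1) - 1 = v + r by ring, show r + 1 - 1 = r by ring,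
        show (r + 1) ^ 2 - (r + 1) = 1 * r ^ 2 + r by ring,
        show (v : ℤ) - (r + 1) = v - r - 1 by ring, x1, x2,
        show r ^ 2 - r = 1 * r ^ 2 - r by ring]
      ring
    rw [Finset.sum_congr rfl fun r _ => key r, sum_Icc_tele f]
    simp only [hf]
    rw [qb_neg_right (k := (v : ℤ) - (R + 1)) (by omega),
      qb_neg_right (k := (v : ℤ) + -R - 1) (by omega), qb_neg_right (k := (v : ℤ) + -R) (by omega)]
    ring

lemma pascal_mul {q : ℝ} (hq0 : 0 < q) (hq1 : q < 1) (N k : ℤ) (Y : ℝ)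
    (hY : N = -1 → k = 0 → Y = 0) :
    Y * qb q (N + 1) k = Y * (qb q N k + q ^ (N + 1 - k) * qb q N (k - 1)) := by
  rcases lt_trichotomy N (-1) with hN | hN | hN
  · have h1 : qb q (N + 1) k = 0 := by by_contra hne; have := qb_ne hne; omega
    have h2 : qb q N k = 0 := by by_contra hne; have := qb_ne hne; omega
    have h3 : qb q N (k - 1) = 0 := by by_contra hne; have := qb_ne hne; omega
    rw [h1, h2, h3]; ring
  · by_cases hk : k = 0
    · rw [hY hN hk]; ring
    · have h1 : qb q (N + 1) k = 0 := by by_contra hne; have := qb_ne hne; omega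
      have h2 : qb q N k = 0 := by by_contra hne; have := qb_ne hne; omega
      have h3 : qb q N (k - 1) = 0 := by by_contra hne; have := qb_ne hne; omega
      rw [h1, h2, h3]; ring
  · rw [qb_pascal1 hq0 hq1 N k (by omega)]

lemma E_source {q h : ℝ} (hq0 : 0 < q) (hq1 : q < 1) (hh0 : 0 < h) (hh : q = h ^ 4)
    (K : ℤ) (hK : 1 ≤ K) (s n : ℕ) (r : ℤ) :
    Et q h K (s + 1) n r = Est q h K 0 s n r := by
  unfold Et Est
  simp only [zero_mul, add_zero]
  obtain ⟨w, hw⟩ : ∃ w : ℤ, w = K * r := ⟨_, rfl⟩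
  rw [show 2 * K * r = 2 * w by rw [hw]; ring]
  by_cases hpar : (s : ℤ) % 2 = 1 ∧ (n : ℤ) % 2 = 0
  swap
  · have h1 : Bq q (s + 1) n (2 * w) (2 * r) = 0 := by
      by_contra hne; have := Bq_ne hne; omega
    have h2 : Bq q (s + 1) n (2 * w + 2) (2 * r) = 0 := by
      by_contra hne; have := Bq_ne hne; omega
    have h3 : Bq q s n (2 * w) (2 * r - 1) = 0 := by
      by_contra hne; have := Bq_ne hne; omega
    have h4 : Bq q s n (2 * w + 2) (2 * r + 1) = 0 := by
      by_contra hne; have := Bq_ne hne; omega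
    rw [h1, h2, h3, h4]
  obtain ⟨S, hS⟩ : ∃ S : ℕ, s = 2 * S + 1 := ⟨s / 2, by omega⟩
  obtain ⟨v, hv⟩ : ∃ v : ℕ, n = 2 * v := ⟨n / 2, by omega⟩
  have e1 : Bq q (s + 1) n (2 * w) (2 * r)
      = qb q (S + 1 + w - r) (v + w) * qb q (S - w + r + 1) (v - w) := by
    unfold Bq
    rw [qb2_eq (S + 1 + w - r) (v + w) (by omega) (by omega),
      qb2_eq (S - w + r + 1) (v - w) (by omega) (by omega)]
  have e2 : Bq q (s + 1) n (2 * w + 2) (2 * r)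
      = qb q (S - w + r) (v - w - 1) * qb q (S + 1 + w - r + 1) (v + w + 1) := by
    unfold Bq
    rw [qb2_eq (S + 1 + w - r + 1) (v + w + 1) (by omega) (by omega),
      qb2_eq (S - w + r) (v - w - 1) (by omega) (by omega), mul_comm]
  have e3 : Bq q s n (2 * w) (2 * r - 1)
      = qb q (S + 1 + w - r) (v + w) * qb q (S - w + r) (v - w) := by
    unfold Bq
    rw [qb2_eq (S + 1 + w - r) (v + w) (by omega) (by omega),
      qb2_eq (S - w + r) (v - w) (by omega) (by omega)]
  have e4 : Bq q s n (2 * w + 2) (2 * r + 1)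
      = qb q (S - w + r) (v - w - 1) * qb q (S + 1 + w - r) (v + w + 1) := by
    unfold Bq
    rw [qb2_eq (S + 1 + w - r) (v + w + 1) (by omega) (by omega),
      qb2_eq (S - w + r) (v - w - 1) (by omega) (by omega), mul_comm]
  have hwr : (0 < r → r ≤ w) ∧ (r < 0 → w ≤ r) ∧ (r = 0 → w = 0) := by
    refine ⟨fun hr => ?_, fun hr => ?_, fun hr => ?_⟩
    · rw [hw]; nlinarith
    · rw [hw]; nlinarith
    · rw [hw, hr]; ring
  rw [e1, e2, e3, e4, pascal_mul hq0 hq1, pascal_mul hq0 hq1, ← q_zpow hh, ← q_zpow hh]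
  · have x1 : q ^ (K * r ^ 2 - r) * q ^ ((S : ℤ) - w + r + 1 - (v - w))
        = q ^ (K * r ^ 2 + r) * q ^ ((S : ℤ) + 1 + w - r + 1 - (v + w + 1)) := by
      rw [← zpow_add₀ hq0.ne', ← zpow_add₀ hq0.ne']; congr 1; ring
    rw [show (v : ℤ) + w + 1 - 1 = v + w by ring]
    linear_combination (qb q (S + 1 + w - r) (v + w) * qb q (S - w + r) (v - w - 1)) * x1
  · intro a1 a2
    by_contra hne
    have := qb_ne hne
    rcases lt_trichotomy r 0 with hr | hr | hr
    · have := hwr.2.1 hr; omega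
    · have := hwr.2.2 hr; omega
    · have := hwr.1 hr; omega
  · intro a1 a2
    by_contra hne
    have := qb_ne hne
    rcases lt_trichotomy r 0 with hr | hr | hr
    · have := hwr.2.1 hr; omega
    · have := hwr.2.2 hr; omega
    · have := hwr.1 hr; omega

lemma Et_sign1 (K r : ℤ) (hK : 1 ≤ K) : 0 ≤ (2 * K * r) * (2 * r) := by
  have : 0 ≤ r * r := mul_self_nonneg r
  nlinarith

lemma Et_sign2 (K r : ℤ) (hK : 1 ≤ K) : 0 ≤ (2 * K * r + 2) * (2 * r) := by
  rcases le_or_gt 0 r with h | h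
  · have : 0 ≤ K * r := by positivity
    nlinarith
  · have h1 : K * r ≤ -1 := by nlinarith
    have : 0 ≤ (-1 - K * r) * (-r) := mul_nonneg (by linarith) (by linarith)
    nlinarith

lemma Est_sign1 (K m r : ℤ) (hK : 1 ≤ K) (hm : 0 ≤ m) :
    0 ≤ (2 * K * r + m * (2 * r - 1)) * (2 * r - 1) := by
  have h1 : 0 ≤ r * (2 * r - 1) := by
    rcases le_or_gt r 0 with h | h
    · exact mul_nonneg_of_nonpos_of_nonpos h (by linarith)
    · exact mul_nonneg h.le (by linarith)
  have h2 : 0 ≤ K * (r * (2 * r - 1)) := mul_nonneg (by linarith) h1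
  have h3 : 0 ≤ m * (2 * r - 1) ^ 2 := by positivity
  nlinarith

lemma Est_sign2 (K m r : ℤ) (hK : 1 ≤ K) (hm : 0 ≤ m) :
    0 ≤ (2 * K * r + 2 + m * (2 * r + 1)) * (2 * r + 1) := by
  have h1 : 0 ≤ (K * r + 1) * (2 * r + 1) := by
    rcases le_or_gt 0 r with h | h
    · have : 0 ≤ K * r := by positivity
      exact mul_nonneg (by linarith) (by linarith)
    · have h1 : K * r ≤ -1 := by nlinarith
      exact mul_nonneg_of_nonpos_of_nonpos (by linarith) (by linarith)
  have h3 : 0 ≤ m * (2 * r + 1) ^ 2 := by positivity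
  nlinarith

lemma Et_step {q h : ℝ} (hq0 : 0 < q) (hq1 : q < 1) (hh0 : 0 < h) (hh : q = h ^ 4)
    (K : ℤ) (hK : 1 ≤ K) (s n : ℕ) (r : ℤ) :
    ∑ n1 ∈ range (n + 1), h ^ (((n : ℤ) - n1) ^ 2) * qb2 q (s + n1) (2 * n) * Et q h K n n1 r
      = Et q h (K + 1) s n r := by
  have b1 := burge hq0 hq1 hh0 hh s n (2 * K * r) (2 * r) (Et_sign1 K r hK)
  have b2 := burge hq0 hq1 hh0 hh s n (2 * K * r + 2) (2 * r) (Et_sign2 K r hK)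
  unfold Et
  rw [show 2 * (K + 1) * r + 2 = 2 * K * r + 2 + 2 * r by ring,
    show 2 * (K + 1) * r = 2 * K * r + 2 * r by ring,
    show 4 * ((K + 1) * r ^ 2 - r) = 4 * (K * r ^ 2 - r) + (2 * r) ^ 2 by ring,
    show 4 * ((K + 1) * r ^ 2 + r) = 4 * (K * r ^ 2 + r) + (2 * r) ^ 2 by ring,
    zpow_add₀ hh0.ne', zpow_add₀ hh0.ne', mul_assoc (h ^ (4 * (K * r ^ 2 - r))),
    mul_assoc (h ^ (4 * (K * r ^ 2 + r))), ← b1, ← b2, Finset.mul_sum, Finset.mul_sum, ← Finset.sum_sub_distrib]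
  exact Finset.sum_congr rfl fun n1 _ => by ring

lemma Est_step {q h : ℝ} (hq0 : 0 < q) (hq1 : q < 1) (hh0 : 0 < h) (hh : q = h ^ 4)
    (K m : ℤ) (hK : 1 ≤ K) (hm : 0 ≤ m) (s n : ℕ) (r : ℤ) :
    ∑ n1 ∈ range (n + 1), h ^ (((n : ℤ) - n1) ^ 2) * qb2 q (s + n1) (2 * n) * Est q h K m n n1 r
      = Est q h K (m + 1) s n r := by
  have b1 := burge hq0 hq1 hh0 hh s n _ _ (Est_sign1 K m r hK hm)
  have b2 := burge hq0 hq1 hh0 hh s n _ _ (Est_sign2 K m r hK hm)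
  unfold Est
  rw [show 2 * K * r + 2 + (m + 1) * (2 * r + 1)
        = 2 * K * r + 2 + m * (2 * r + 1) + (2 * r + 1) by ring,
    show 2 * K * r + (m + 1) * (2 * r - 1) = 2 * K * r + m * (2 * r - 1) + (2 * r - 1) by ring,
    show 4 * (K * r ^ 2 - r) + (m + 1) * (2 * r - 1) ^ 2
      = 4 * (K * r ^ 2 - r) + m * (2 * r - 1) ^ 2 + (2 * r - 1) ^ 2 by ring,
    show 4 * (K * r ^ 2 + r) + (m + 1) * (2 * r + 1) ^ 2
      = 4 * (K * r ^ 2 + r) + m * (2 * r + 1) ^ 2 + (2 * r + 1) ^ 2 by ring,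
    zpow_add₀ hh0.ne' _ ((2 * r - 1) ^ 2), zpow_add₀ hh0.ne' _ ((2 * r + 1) ^ 2),
    mul_assoc (h ^ (4 * (K * r ^ 2 - r) + m * (2 * r - 1) ^ 2)),
    mul_assoc (h ^ (4 * (K * r ^ 2 + r) + m * (2 * r + 1) ^ 2)), ← b1, ← b2, Finset.mul_sum, Finset.mul_sum, ← Finset.sum_sub_distrib]
  exact Finset.sum_congr rfl fun n1 _ => by ring

/-- The fermionic chain: `k` nodes, with a source at the `σ`-th node from the end. -/
def Gf (q h : ℝ) (σ : ℕ) : ℕ → ℕ → ℕ → ℝ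
  | 0, s, n => if n = 0 ∧ s % 2 = 0 then 1 else 0
  | k + 1, s, n => ∑ n1 ∈ range (n + 1), h ^ (((n : ℤ) - n1) ^ 2) *
      qb2 q (((s + if k + 1 = σ then 1 else 0 : ℕ) : ℤ) + n1) (2 * n) * Gf q h σ k n n1

lemma E2_base {q h : ℝ} (hq0 : 0 < q) (hq1 : q < 1) (hh0 : 0 < h) (hh : q = h ^ 4)
    (s n R : ℕ) (hR : n + 2 ≤ R) :
    ∑ r ∈ Icc (-(R : ℤ)) R, Et q h 2 s n r = if n = 0 ∧ s % 2 = 0 then 1 else 0 := by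
  rw [show (2 : ℤ) = 1 + 1 by norm_num,
    Finset.sum_congr rfl fun r _ => (Et_step hq0 hq1 hh0 hh 1 le_rfl s n r).symm,
    Finset.sum_comm]
  rw [Finset.sum_congr rfl fun n1 hn1 => by
    rw [← Finset.mul_sum, E_base hq0 hq1 hh0 hh n n1 R
      (by have := Finset.mem_range.mp hn1; omega)]]
  by_cases hn : n = 0
  · subst hn
    simp only [qb2]
    by_cases hs : s % 2 = 0
    · have : (s : ℤ) % 2 = 0 := by omega
      simp [hs, this, qb_zero hq0 hq1 (show (0 : ℤ) ≤ (s : ℤ) / 2 by omega)]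
    · have : ¬ (s : ℤ) % 2 = 0 := by omega
      simp only [zero_add, Finset.sum_range_one]
      simp [hs]; intro h2; omega
  · simp [hn]

lemma Gf_E {q h : ℝ} (hq0 : 0 < q) (hq1 : q < 1) (hh0 : 0 < h) (hh : q = h ^ 4) (σ R : ℕ)
    (k : ℕ) (hk : k < σ) (s n : ℕ) (hR : n + 2 ≤ R) :
    Gf q h σ k s n = ∑ r ∈ Icc (-(R : ℤ)) R, Et q h (k + 2) s n r := by
  induction k generalizing s n with
  | zero => simp only [Gf, CharP.cast_eq_zero, zero_add, E2_base hq0 hq1 hh0 hh s n R hR]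
  | succ k ih =>
    simp only [Gf, if_neg hk.ne, add_zero]
    rw [Finset.sum_congr rfl fun n1 hn1 => by
      rw [ih (by omega) n n1 (by have := Finset.mem_range.mp hn1; omega), Finset.mul_sum]]
    rw [Finset.sum_comm]
    refine Finset.sum_congr rfl fun r _ => ?_
    rw [Et_step hq0 hq1 hh0 hh _ (by omega)]
    congr 1

lemma Gf_Es {q h : ℝ} (hq0 : 0 < q) (hq1 : q < 1) (hh0 : 0 < h) (hh : q = h ^ 4) (σ R : ℕ)
    (hσ : 1 ≤ σ) (m s n : ℕ) (hR : n + 2 ≤ R) :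
    Gf q h σ (σ + m) s n = ∑ r ∈ Icc (-(R : ℤ)) R, Est q h (σ + 2) m s n r := by
  induction m generalizing s n with
  | zero =>
    obtain ⟨k, rfl⟩ : ∃ k, σ = k + 1 := ⟨σ - 1, by omega⟩
    simp only [Gf, add_zero, if_true]
    rw [Finset.sum_congr rfl fun n1 hn1 => by
      rw [Gf_E hq0 hq1 hh0 hh (k + 1) R k (by omega) n n1
        (by have := Finset.mem_range.mp hn1; omega), Finset.mul_sum]]
    rw [Finset.sum_comm]
    refine Finset.sum_congr rfl fun r _ => ?_
    rw [Et_step hq0 hq1 hh0 hh _ (by omega)]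
    have := E_source hq0 hq1 hh0 hh ((k : ℤ) + 2 + 1) (by omega) s n r
    push_cast
    rw [this]
    congr 1
  | succ m ih =>
    rw [← add_assoc]
    simp only [Gf, if_neg (show ¬ (σ + m + 1 = σ) by omega), add_zero]
    rw [Finset.sum_congr rfl fun n1 hn1 => by
      rw [ih n n1 (by have := Finset.mem_range.mp hn1; omega), Finset.mul_sum]]
    rw [Finset.sum_comm]
    refine Finset.sum_congr rfl fun r _ => ?_
    rw [Est_step hq0 hq1 hh0 hh _ _ (by omega) (by omega)]
    congr 1


lemma Gf_nonneg {q h : ℝ} (hq0 : 0 < q) (hq1 : q < 1) (hh0 : 0 < h) (σ k s n : ℕ) :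
    0 ≤ Gf q h σ k s n := by
  induction k generalizing s n with
  | zero => simp only [Gf]; split_ifs <;> norm_num
  | succ k ih =>
    simp only [Gf]
    exact Finset.sum_nonneg fun n1 _ =>
      mul_nonneg (mul_nonneg (zpow_pos hh0 _).le (qb2_nonneg hq0 hq1 _ _)) (ih _ _)

lemma Gf_ne1 {q h : ℝ} (hq0 : 0 < q) (hq1 : q < 1) (hh0 : 0 < h) (hh : q = h ^ 4) (σ : ℕ)
    (k : ℕ) (hk : k < σ) (s n : ℕ) (hne : Gf q h σ k s n ≠ 0) : n ≤ s ∧ n % 2 = 0 := by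
  rw [Gf_E hq0 hq1 hh0 hh σ (n + 2) k hk s n le_rfl] at hne
  obtain ⟨r, -, hr⟩ := Finset.exists_ne_zero_of_sum_ne_zero hne
  unfold Et at hr
  obtain ⟨w, hw⟩ : ∃ w : ℤ, w = ((k : ℤ) + 2) * r := ⟨_, rfl⟩
  rw [show 2 * ((k : ℤ) + 2) * r = 2 * w by rw [hw]; ring] at hr
  by_cases h1 : Bq q s n (2 * w) (2 * r) = 0
  · by_cases h2 : Bq q s n (2 * w + 2) (2 * r) = 0
    · rw [h1, h2] at hr; simp at hr
    · have := Bq_ne h2; omega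
  · have := Bq_ne h1; omega

lemma Gf_ne2 {q h : ℝ} (hq0 : 0 < q) (hq1 : q < 1) (hh0 : 0 < h) (hh : q = h ^ 4) (σ : ℕ)
    (hσ : 1 ≤ σ) (m s n : ℕ) (hne : Gf q h σ (σ + m) s n ≠ 0) : n ≤ s ∧ n % 2 = m % 2 := by
  rw [Gf_Es hq0 hq1 hh0 hh σ (n + 2) hσ m s n le_rfl] at hne
  obtain ⟨r, -, hr⟩ := Finset.exists_ne_zero_of_sum_ne_zero hne
  unfold Est at hr
  obtain ⟨w, hw⟩ : ∃ w : ℤ, w = ((σ : ℤ) + 2) * r := ⟨_, rfl⟩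
  obtain ⟨z, hz⟩ : ∃ z : ℤ, z = (m : ℤ) * r := ⟨_, rfl⟩
  rw [show 2 * ((σ : ℤ) + 2) * r = 2 * w by rw [hw]; ring] at hr
  by_cases h1 : Bq q s n (2 * w + m * (2 * r - 1)) (2 * r - 1) = 0
  · by_cases h2 : Bq q s n (2 * w + 2 + m * (2 * r + 1)) (2 * r + 1) = 0
    · rw [h1, h2] at hr; simp at hr
    · have := Bq_ne h2
      rw [show (m : ℤ) * (2 * r + 1) = 2 * z + m by rw [hz]; ring] at this
      omega
  · have := Bq_ne h1
    rw [show (m : ℤ) * (2 * r - 1) = 2 * z - m by rw [hz]; ring] at this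
    omega

lemma Gf_le {q h : ℝ} (hq0 : 0 < q) (hq1 : q < 1) (hh0 : 0 < h) (hh : q = h ^ 4) (σ : ℕ)
    (hσ : 1 ≤ σ) (k s n : ℕ) (hne : Gf q h σ k s n ≠ 0) : n ≤ s := by
  rcases lt_or_ge k σ with hk | hk
  · exact (Gf_ne1 hq0 hq1 hh0 hh σ k hk s n hne).1
  · obtain ⟨m, rfl⟩ := Nat.exists_eq_add_of_le hk
    exact (Gf_ne2 hq0 hq1 hh0 hh σ hσ m s n hne).1

/-- Prepend a value to a sequence. -/
def ncons (s : ℕ) (N : ℕ → ℕ) : ℕ → ℕ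
  | 0 => s
  | t + 1 => N t

/-- Extension of a finite vector by zero. -/
def ext0 {k : ℕ} (c : Fin k → ℕ) : ℕ → ℕ := fun t => if h : t < k then c ⟨t, h⟩ else 0

lemma ext0_cons {k : ℕ} (n : ℕ) (c : Fin k → ℕ) :
    ext0 (Fin.cons n c : Fin (k + 1) → ℕ) = ncons n (ext0 c) := by
  funext t
  cases t with
  | zero => simp [ext0, ncons]
  | succ t =>
    by_cases ht : t < k
    · simp only [ext0, ncons, ht, dif_pos, Nat.succ_lt_succ ht]
      exact Fin.cons_succ (α := fun _ => ℕ) n c ⟨t, ht⟩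
    · have : ¬ (t + 1 < k + 1) := by omega
      simp [ext0, ncons, ht]

lemma ext0_val {k : ℕ} (c : Fin k → ℕ) (i : Fin k) : ext0 c i = c i := by
  simp [ext0]

lemma ext0_ge {k : ℕ} (c : Fin k → ℕ) (t : ℕ) (ht : k ≤ t) : ext0 c t = 0 := by
  simp [ext0, not_lt.mpr ht]

/-- Weight of a chain configuration. -/
def Wt (q h : ℝ) (σ k : ℕ) (N : ℕ → ℕ) : ℝ :=
  h ^ (∑ t ∈ range k, ((N (t + 1) : ℤ) - N (t + 2)) ^ 2) *
    (∏ t ∈ range k, qb2 q (((N t + if k - t = σ then 1 else 0 : ℕ) : ℤ) + N (t + 2))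
      (2 * N (t + 1))) * if N k % 2 = 0 then 1 else 0

lemma Wt_succ {q h : ℝ} (hh0 : 0 < h) (σ k : ℕ) (s : ℕ) (N : ℕ → ℕ) :
    Wt q h σ (k + 1) (ncons s N) = h ^ (((N 0 : ℤ) - N 1) ^ 2) *
      qb2 q (((s + if k + 1 = σ then 1 else 0 : ℕ) : ℤ) + N 1) (2 * N 0) * Wt q h σ k N := by
  unfold Wt
  rw [Finset.sum_range_succ', Finset.prod_range_succ', zpow_add₀ hh0.ne']
  simp only [ncons, Nat.add_sub_add_right]
  have key : ∀ a b c d e : ℝ, a * b * (c * d) * e = b * d * (a * c * e) := by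
    intros; ring
  exact key _ _ _ _ _

lemma Wt_nonneg {q h : ℝ} (hq0 : 0 < q) (hq1 : q < 1) (hh0 : 0 < h) (σ k : ℕ) (N : ℕ → ℕ) :
    0 ≤ Wt q h σ k N := by
  unfold Wt
  refine mul_nonneg (mul_nonneg (zpow_pos hh0 _).le
    (Finset.prod_nonneg fun t _ => qb2_nonneg hq0 hq1 _ _)) ?_
  split_ifs <;> norm_num

lemma hasSum_fib {β : Type*} (f : ℕ × β → ℝ) (hf : ∀ x, 0 ≤ f x) (g : ℕ → ℝ) (S : ℝ)
    (h1 : ∀ n, HasSum (fun b => f (n, b)) (g n)) (h2 : HasSum g S) : HasSum f S := by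
  have hs : Summable f := by
    rw [summable_prod_of_nonneg hf]
    refine ⟨fun n => (h1 n).summable, ?_⟩
    simp only [(h1 _).tsum_eq]
    exact h2.summable
  have := hs.tsum_prod' (fun n => (h1 n).summable)
  simp only [(h1 _).tsum_eq, h2.tsum_eq] at this
  rw [← this]
  exact hs.hasSum

lemma hasSum_cons {k : ℕ} (f : (Fin (k + 1) → ℕ) → ℝ) (hf : ∀ x, 0 ≤ f x) (g : ℕ → ℝ) (S : ℝ)
    (h1 : ∀ n, HasSum (fun c : Fin k → ℕ => f (Fin.cons n c)) (g n)) (h2 : HasSum g S) :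
    HasSum f S := by
  have := hasSum_fib (fun x : ℕ × (Fin k → ℕ) => f (Fin.cons x.1 x.2)) (fun _ => hf _) g S h1 h2
  rw [← (Fin.consEquiv (fun _ : Fin (k + 1) => ℕ)).hasSum_iff]
  exact this

lemma hasSum_range (g : ℕ → ℝ) (R : ℕ) (hg : ∀ n, g n ≠ 0 → n < R) :
    HasSum g (∑ n ∈ range R, g n) := by
  apply hasSum_sum_of_ne_finset_zero
  intro n hn
  by_contra hne
  exact hn (Finset.mem_range.mpr (hg n hne))

lemma chain_hasSum {q h : ℝ} (hq0 : 0 < q) (hq1 : q < 1) (hh0 : 0 < h) (hh : q = h ^ 4) (σ : ℕ)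
    (hσ : 1 ≤ σ) (k s n : ℕ) :
    HasSum (fun c : Fin k → ℕ => Wt q h σ (k + 1) (ncons s (ncons n (ext0 c))))
      (Gf q h σ (k + 1) s n) := by
  induction k generalizing s n with
  | zero =>
    have : Gf q h σ (0 + 1) s n = Wt q h σ (0 + 1) (ncons s (ncons n (ext0 (default : Fin 0 → ℕ)))) := by
      rw [Wt_succ hh0]
      simp only [Gf, Wt, ncons, ext0_ge _ _ (Nat.zero_le _)]
      rw [Finset.sum_eq_single 0]
      · simp
        by_cases hn : n % 2 = 0 <;> simp [hn]
      · intro b _ hb; simp [hb]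
      · intro hb; simp at hb
    rw [this]
    exact hasSum_unique _
  | succ k ih =>
    refine hasSum_cons _ (fun c => Wt_nonneg hq0 hq1 hh0 _ _ _)
      (fun n1 => h ^ (((n : ℤ) - n1) ^ 2) *
      qb2 q (((s + if k + 1 + 1 = σ then 1 else 0 : ℕ) : ℤ) + n1) (2 * n) * Gf q h σ (k + 1) n n1)
      _ ?_ ?_
    · intro n1
      have := (ih n n1).mul_left (h ^ (((n : ℤ) - n1) ^ 2) *
        qb2 q (((s + if k + 1 + 1 = σ then 1 else 0 : ℕ) : ℤ) + n1) (2 * n))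
      refine this.congr_fun ?_
      intro c
      rw [ext0_cons, Wt_succ hh0]
      rfl
    · rw [show Gf q h σ (k + 1 + 1) s n = ∑ n1 ∈ range (n + 1), h ^ (((n : ℤ) - n1) ^ 2) *
      qb2 q (((s + if k + 1 + 1 = σ then 1 else 0 : ℕ) : ℤ) + n1) (2 * n) * Gf q h σ (k + 1) n n1
        by rw [Gf]]
      apply hasSum_range
      intro n1 hne
      have := Gf_le hq0 hq1 hh0 hh σ hσ _ _ _ (right_ne_zero_of_mul hne)
      omega


/-- The rows of `Ĩ m`. -/
def Tt (M : ℕ → ℕ) (i : ℕ) : ℤ :=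
  if i = 0 then -(M 2 : ℤ) else if i = 1 then M 2
  else if i = 2 then (M 0 + M 1 : ℤ) + M 3 else (M (i - 1) : ℤ) + M (i + 1)

lemma sum_single_ext {n : ℕ} (m : Fin n → ℕ) (t : ℕ) :
    ∑ j ∈ range n, (if j = t then (1 : ℚ) else 0) * (ext0 m j : ℚ) = (ext0 m t : ℚ) := by
  by_cases ht : t < n
  · rw [Finset.sum_eq_single t]
    · simp
    · intro b _ hb; simp [hb]
    · intro hb; exact absurd (Finset.mem_range.mpr ht) hb
  · rw [ext0_ge m t (by omega)]
    refine (Finset.sum_eq_zero fun j hj => ?_).trans (by simp)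
    have := Finset.mem_range.mp hj
    rw [if_neg (by omega), zero_mul]

lemma It_sum (k : ℕ) (m : Fin (k + 3) → ℕ) (i : Fin (k + 3)) :
    ∑ j : Fin (k + 3), ItM (k + 4) i j * (m j : ℚ) = (Tt (ext0 m) i : ℚ) := by
  obtain ⟨F, hF⟩ : ∃ F : ℕ → ℚ, F = (fun j : ℕ => (if i.val = 0 then (if j = 2 then -1 else 0)
        else if j = 0 then (if i.val = 2 then 1 else 0)
        else if i.val = j + 1 ∨ j = i.val + 1 then 1 else (0 : ℚ)) * (ext0 m j : ℚ)) := ⟨_, rfl⟩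
  have e : ∀ j : Fin (k + 3), ItM (k + 4) i j * (m j : ℚ) = F j.val := by
    intro j
    simp only [hF, ext0_val]
    rfl
  rw [Finset.sum_congr rfl fun j _ => e j, Fin.sum_univ_eq_sum_range F, hF]
  clear hF e
  obtain ⟨i, hi⟩ := i
  simp only
  rcases i with _ | _ | _ | i
  · rw [show Tt (ext0 m) 0 = -(ext0 m 2 : ℤ) by simp [Tt], Int.cast_neg, Int.cast_natCast,
      ← sum_single_ext m 2, ← Finset.sum_neg_distrib]
    refine Finset.sum_congr rfl fun j _ => ?_
    by_cases h2 : j = 2 <;> simp [h2]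
  · rw [show Tt (ext0 m) (0 + 1) = (ext0 m 2 : ℤ) by simp [Tt], Int.cast_natCast,
      ← sum_single_ext m 2]
    refine Finset.sum_congr rfl fun j _ => ?_
    congr 1
    by_cases h0 : j = 0
    · subst h0; simp
    · by_cases h2 : j = 2
      · subst h2; simp
      · rw [if_neg (by omega), if_neg h0, if_neg (by omega), if_neg h2]
  · rw [show Tt (ext0 m) (0 + 1 + 1) = ((ext0 m 0 + ext0 m 1 + ext0 m 3 : ℕ) : ℤ) by simp [Tt],
      Int.cast_natCast, Nat.cast_add, Nat.cast_add,
      ← sum_single_ext m 0, ← sum_single_ext m 1, ← sum_single_ext m 3,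
      ← Finset.sum_add_distrib, ← Finset.sum_add_distrib]
    refine Finset.sum_congr rfl fun j _ => ?_
    rw [← add_mul, ← add_mul]
    congr 1
    by_cases h0 : j = 0
    · subst h0; simp
    · by_cases h1 : j = 1
      · subst h1; simp
      · by_cases h3 : j = 3
        · subst h3; simp
        · rw [if_neg (by omega), if_neg h0, if_neg (by omega), if_neg h0, if_neg h1, if_neg h3]
          norm_num
  · rw [show Tt (ext0 m) (i + 1 + 1 + 1) = ((ext0 m (i + 2) + ext0 m (i + 4) : ℕ) : ℤ) by
        simp [Tt],
      Int.cast_natCast, Nat.cast_add,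
      ← sum_single_ext m (i + 2), ← sum_single_ext m (i + 4), ← Finset.sum_add_distrib]
    refine Finset.sum_congr rfl fun j _ => ?_
    rw [← add_mul]
    congr 1
    rw [if_neg (by omega)]
    by_cases h0 : j = 0
    · subst h0; simp
    · rw [if_neg h0]
      by_cases h2 : j = i + 2
      · rw [if_pos (by omega), if_pos h2, if_neg (by omega)]; norm_num
      · by_cases h4 : j = i + 4
        · rw [if_pos (by omega), if_neg h2, if_pos h4]; norm_num
        · rw [if_neg (by omega), if_neg h2, if_neg h4]; norm_num

lemma quad_chain (N : ℕ → ℕ) (k : ℕ) :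
    ∑ t ∈ range k, (N (t + 1) : ℤ) * (2 * N (t + 1) - N t - N (t + 2))
      = ∑ t ∈ range k, ((N (t + 1) : ℤ) - N (t + 2)) ^ 2 + (N 1 : ℤ) ^ 2 - N 0 * N 1
        + N k * N (k + 1) - (N (k + 1) : ℤ) ^ 2 := by
  induction k with
  | zero => simp
  | succ k ih => rw [Finset.sum_range_succ, Finset.sum_range_succ, ih]; ring

lemma Tt_chain (m0 m1 : ℕ) (N : ℕ → ℕ) (t : ℕ) :
    Tt (ncons m0 (ncons m1 N)) (t + 2) = (ncons (m0 + m1) N t : ℤ) + ncons (m0 + m1) N (t + 2) := by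
  rcases t with _ | t
  · simp [Tt, ncons]
  · simp [Tt, ncons]

lemma qBinQ_half {q : ℝ} (x : ℤ) (m : ℕ) :
    qBinQ q ((x : ℚ) / 2) m = qb2 q x (2 * m) := by
  unfold qBinQ qb2
  by_cases hx : x % 2 = 0
  · obtain ⟨X, rfl⟩ : ∃ X, x = 2 * X := ⟨x / 2, by omega⟩
    have e : (((2 * X : ℤ) : ℚ) / 2) = (X : ℚ) := by push_cast; ring
    rw [e, if_pos (show 2 * X % 2 = 0 ∧ 2 * (m : ℤ) % 2 = 0 by omega),
      show 2 * X / 2 = X by omega, show 2 * (m : ℤ) / 2 = m by omega]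
    simp only [Rat.den_intCast, true_and, Rat.num_intCast]
    by_cases hm : (m : ℤ) ≤ X
    · rw [if_pos (by exact_mod_cast hm)]
      unfold qb rp qp
      rw [if_pos (by omega), if_pos (by omega), div_eq_mul_inv, mul_inv, Int.toNat_natCast,
        show (X - (m : ℤ)).toNat = X.toNat - m by omega]
      ring
    · rw [if_neg (by intro h; exact hm (by exact_mod_cast h)), qb_gt (by omega)]
  · rw [if_neg (c := x % 2 = 0 ∧ 2 * (m : ℤ) % 2 = 0) (by omega), if_neg]
    rintro ⟨h1, -⟩
    have h2 : ((x : ℚ) / 2) = (((x : ℚ) / 2).num : ℚ) := (Rat.coe_int_num_of_den_eq_one h1).symm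
    have h3 : (x : ℚ) = ((2 * ((x : ℚ) / 2).num : ℤ) : ℚ) := by
      push_cast; linarith
    have h4 : x = 2 * ((x : ℚ) / 2).num := by exact_mod_cast h3
    omega


lemma quad_sum (k : ℕ) (m : Fin (k + 3) → ℕ) :
    ∑ i : Fin (k + 3), ∑ j : Fin (k + 3), (m i : ℚ) * CtM (k + 4) i j * (m j : ℚ)
      = ((∑ i ∈ range (k + 3), (ext0 m i : ℤ) * (2 * ext0 m i - Tt (ext0 m) i) : ℤ) : ℚ) := by
  obtain ⟨F, hF⟩ : ∃ F : ℕ → ℤ, F = fun i => (ext0 m i : ℤ) * (2 * ext0 m i - Tt (ext0 m) i) :=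
    ⟨_, rfl⟩
  rw [show (∑ i ∈ range (k + 3), (ext0 m i : ℤ) * (2 * ext0 m i - Tt (ext0 m) i))
    = ∑ i ∈ range (k + 3), F i by rw [hF], ← Fin.sum_univ_eq_sum_range F, Int.cast_sum]
  refine Finset.sum_congr rfl fun i _ => ?_
  simp only [hF]
  push_cast
  rw [← It_sum, ext0_val]
  have e : ∀ j : Fin (k + 3), (m i : ℚ) * CtM (k + 4) i j * (m j : ℚ)
      = (if i = j then (m i : ℚ) * 2 * m j else 0) - (m i : ℚ) * (ItM (k + 4) i j * (m j : ℚ)) := by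
    intro j
    unfold CtM
    by_cases hij : i = j
    · rw [if_pos hij, if_pos hij]; ring
    · rw [if_neg hij, if_neg hij]; ring
  rw [Finset.sum_congr rfl fun j _ => e j, Finset.sum_sub_distrib, ← Finset.mul_sum,
    Finset.sum_ite_eq, if_pos (Finset.mem_univ _)]
  ring

lemma quad_eval (k m0 m1 : ℕ) (N : ℕ → ℕ) (hN : N (k + 1) = 0) :
    ∑ i ∈ range (k + 3), (ncons m0 (ncons m1 N) i : ℤ)
        * (2 * ncons m0 (ncons m1 N) i - Tt (ncons m0 (ncons m1 N)) i)
      = 2 * (m0 : ℤ) ^ 2 + 2 * (m1 : ℤ) ^ 2 - 2 * m1 * N 0 + (N 0 : ℤ) ^ 2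
        + ∑ t ∈ range (k + 1), ((ncons (m0 + m1) N (t + 1) : ℤ) - ncons (m0 + m1) N (t + 2)) ^ 2 := by
  rw [Finset.sum_range_succ', Finset.sum_range_succ']
  have e : ∀ t : ℕ, (ncons m0 (ncons m1 N) (t + 1 + 1) : ℤ)
        * (2 * ncons m0 (ncons m1 N) (t + 1 + 1) - Tt (ncons m0 (ncons m1 N)) (t + 1 + 1))
      = (ncons (m0 + m1) N (t + 1) : ℤ) * (2 * ncons (m0 + m1) N (t + 1) - ncons (m0 + m1) N t
        - ncons (m0 + m1) N (t + 2)) := by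
    intro t
    rw [Tt_chain]
    simp only [ncons]
    ring
  rw [Finset.sum_congr rfl fun t _ => e t, quad_chain]
  have h1 : ncons (m0 + m1) N (k + 1 + 1) = 0 := hN
  rw [h1]
  simp only [Tt, ncons]
  push_cast
  simp
  ring

lemma top_eq (k L : ℕ) (u : Fin (k + 3) → ℚ) (m : Fin (k + 3) → ℕ) (i : Fin (k + 3)) :
    topVec (k + 4) L u m i
      = ((Tt (ext0 m) i : ℚ) + 2 * (if i.val = 0 then (L : ℚ) else 0) + u i) / 2 := by
  have e := It_sum k m i
  have : topVec (k + 4) L u m i = (∑ j : Fin (k + 3), ItM (k + 4) i j * (m j : ℚ)) / 2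
    + (L : ℚ) * (if i.val = 0 then 1 else 0) + u i / 2 := rfl
  rw [this, e]
  split_ifs <;> ring

lemma uvec_eq (k a : ℕ) (ha1 : 1 ≤ a) (i : Fin (k + 3)) :
    uvec (k + 4) 0 a 1 i = (((if 1 < a ∧ i.val = a then 1 else 0)
      + (((a + kdel a 1) % 2 : ℕ) : ℤ) * ((if i.val = 1 then 1 else 0) - (if i.val = 0 then 1 else 0)) : ℤ) : ℚ) := by
  have hpt : ptil (a + kdel a 1 + 1 + kdel 1 1 + (if (0 : ℕ) = 1 then k + 4 - 1 else 0))
      = (((a + kdel a 1) % 2 : ℕ) : ℚ) := by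
    unfold ptil
    rw [show kdel 1 1 = 1 from rfl, if_neg (by omega : ¬ (0 : ℕ) = 1)]
    rcases Nat.mod_two_eq_zero_or_one (a + kdel a 1) with h | h
    · rw [h, if_neg (by omega)]; norm_num
    · rw [h, if_pos (by omega)]; norm_num
  unfold uvec evec
  rw [hpt]
  push_cast
  congr 1
  simp only [lt_irrefl, if_false, add_zero]
  by_cases h1 : 1 < a
  · simp [h1]
  · simp [h1]

lemma Phi_eq (k a : ℕ) (m0 m1 : ℕ) (c : Fin (k + 1) → ℕ) :
    PhiQ (k + 4) (Avec (k + 4) 0 a 1) (Fin.cons m0 (Fin.cons m1 c) : Fin (k + 3) → ℕ)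
      = ((2 * (m0 : ℤ) ^ 2 + 2 * (m1 : ℤ) ^ 2 - 2 * m1 * ext0 c 0 + (ext0 c 0 : ℤ) ^ 2
        - 2 * (((a + kdel a 1) % 2 : ℕ) : ℤ) * m1
        + ∑ t ∈ range (k + 1), ((ncons (m0 + m1) (ext0 c) (t + 1) : ℤ)
          - ncons (m0 + m1) (ext0 c) (t + 2)) ^ 2 : ℤ) : ℚ) / 4 := by
  have hpt : ptil (a + kdel a 1 + 1 + kdel 1 1 + (if (0 : ℕ) = 1 then k + 4 - 1 else 0))
      = (((a + kdel a 1) % 2 : ℕ) : ℚ) := by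
    unfold ptil
    rw [show kdel 1 1 = 1 from rfl, if_neg (by omega : ¬ (0 : ℕ) = 1)]
    rcases Nat.mod_two_eq_zero_or_one (a + kdel a 1) with h | h
    · rw [h, if_neg (by omega)]; norm_num
    · rw [h, if_pos (by omega)]; norm_num
  have hA : ∑ j : Fin (k + 3), Avec (k + 4) 0 a 1 j
      * ((Fin.cons m0 (Fin.cons m1 c) : Fin (k + 3) → ℕ) j : ℚ)
      = (((a + kdel a 1) % 2 : ℕ) : ℚ) * m1 := by
    rw [Finset.sum_eq_single (1 : Fin (k + 3))]
    · have : Avec (k + 4) 0 a 1 (1 : Fin (k + 3)) = (((a + kdel a 1) % 2 : ℕ) : ℚ) := by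
        unfold Avec evec
        rw [hpt]
        simp
      rw [this]
      rfl
    · intro b _ hb
      have : Avec (k + 4) 0 a 1 b = 0 := by
        unfold Avec evec
        rw [if_neg (lt_irrefl 1), if_neg (c := b.val = 1)]
        · ring
        · intro h; exact hb (Fin.ext h)
      rw [this, zero_mul]
    · intro hb; exact absurd (Finset.mem_univ _) hb
  have hQ := quad_sum k (Fin.cons m0 (Fin.cons m1 c))
  rw [ext0_cons, ext0_cons, quad_eval k m0 m1 (ext0 c) (ext0_ge c _ le_rfl)] at hQ
  have e : PhiQ (k + 4) (Avec (k + 4) 0 a 1) (Fin.cons m0 (Fin.cons m1 c) : Fin (k + 3) → ℕ)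
    = (∑ i : Fin (k + 3), ∑ j : Fin (k + 3),
      ((Fin.cons m0 (Fin.cons m1 c) : Fin (k + 3) → ℕ) i : ℚ) * CtM (k + 4) i j
        * ((Fin.cons m0 (Fin.cons m1 c) : Fin (k + 3) → ℕ) j : ℚ)) / 4
      - (∑ j : Fin (k + 3), Avec (k + 4) 0 a 1 j
      * ((Fin.cons m0 (Fin.cons m1 c) : Fin (k + 3) → ℕ) j : ℚ)) / 2 := rfl
  rw [e, hA, hQ]
  generalize (a + kdel a 1) % 2 = ε
  push_cast
  ring

lemma term_eq {q h : ℝ} (hq0 : 0 < q) (hh0 : 0 < h) (hh : q = h ^ 4)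
    (k a L : ℕ) (ha1 : 1 ≤ a) (ha2 : a ≤ k + 2) (m0 m1 : ℕ) (c : Fin (k + 1) → ℕ) :
    (if mlast (k + 4) (Fin.cons m0 (Fin.cons m1 c) : Fin (k + 3) → ℕ) % 2 = 0 % 2 then
      q ^ ((PhiQ (k + 4) (Avec (k + 4) 0 a 1)
        (Fin.cons m0 (Fin.cons m1 c) : Fin (k + 3) → ℕ) : ℝ)) *
      ∏ i : Fin (k + 3), qBinQ q (topVec (k + 4) L (uvec (k + 4) 0 a 1)
        (Fin.cons m0 (Fin.cons m1 c) : Fin (k + 3) → ℕ) i)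
        ((Fin.cons m0 (Fin.cons m1 c) : Fin (k + 3) → ℕ) i)
      else 0)
    = h ^ (2 * (m0 : ℤ) ^ 2 + 2 * (m1 : ℤ) ^ 2 - 2 * m1 * ext0 c 0 + (ext0 c 0 : ℤ) ^ 2
        - 2 * (((a + kdel a 1) % 2 : ℕ) : ℤ) * m1)
      * qb2 q (2 * L - ext0 c 0 - (((a + kdel a 1) % 2 : ℕ) : ℤ)) (2 * m0)
      * qb2 q (ext0 c 0 + (((a + kdel a 1) % 2 : ℕ) : ℤ)) (2 * m1)
      * Wt q h (k + 3 - a) (k + 1) (ncons (m0 + m1) (ext0 c)) := by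
  obtain ⟨ε, hε⟩ : ∃ ε : ℕ, ε = (a + kdel a 1) % 2 := ⟨_, rfl⟩
  have hpow : ∀ z : ℤ, q ^ ((((z : ℚ) / 4 : ℚ)) : ℝ) = h ^ z := by
    intro z
    rw [hh, ← Real.rpow_natCast, ← Real.rpow_mul hh0.le, ← Real.rpow_intCast]
    congr 1
    push_cast
    ring
  obtain ⟨G, hG⟩ : ∃ G : ℕ → ℝ, G = fun i => qb2 q (Tt (ncons m0 (ncons m1 (ext0 c))) i
      + 2 * (if i = 0 then (L : ℤ) else 0) + ((if 1 < a ∧ i = a then 1 else 0)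
      + (ε : ℤ) * ((if i = 1 then 1 else 0) - (if i = 0 then 1 else 0))))
      (2 * ncons m0 (ncons m1 (ext0 c)) i) := ⟨_, rfl⟩
  have hprod : ∏ i : Fin (k + 3), qBinQ q (topVec (k + 4) L (uvec (k + 4) 0 a 1)
        (Fin.cons m0 (Fin.cons m1 c) : Fin (k + 3) → ℕ) i)
        ((Fin.cons m0 (Fin.cons m1 c) : Fin (k + 3) → ℕ) i) = ∏ i ∈ range (k + 3), G i := by
    rw [← Fin.prod_univ_eq_prod_range G]
    refine Finset.prod_congr rfl fun i _ => ?_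
    rw [top_eq, uvec_eq k a ha1 i, ← hε, hG]
    simp only
    rw [← ext0_cons, ← ext0_cons, ext0_val, ← qBinQ_half]
    congr 1
    push_cast
    rfl
  have hlast : mlast (k + 4) (Fin.cons m0 (Fin.cons m1 c) : Fin (k + 3) → ℕ)
      = ncons (m0 + m1) (ext0 c) (k + 1) := by
    have : mlast (k + 4) (Fin.cons m0 (Fin.cons m1 c) : Fin (k + 3) → ℕ)
      = (Fin.cons m0 (Fin.cons m1 c) : Fin (k + 3) → ℕ) ⟨k + 2, by omega⟩ := by
      unfold mlast
      rw [dif_pos (by omega)]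
      rfl
    rw [this, ← ext0_val (Fin.cons m0 (Fin.cons m1 c) : Fin (k + 3) → ℕ), ext0_cons, ext0_cons]
    rfl
  rw [hprod, hlast, Phi_eq, hpow, ← hε, Finset.prod_range_succ', Finset.prod_range_succ',
    zpow_add₀ hh0.ne']
  have g0 : G 0 = qb2 q (2 * L - ext0 c 0 - (ε : ℤ)) (2 * m0) := by
    rw [hG]
    simp only [Tt, ncons]
    rw [if_neg (c := 1 < a ∧ 0 = a) (by omega)]
    simp
    congr 1
    ring
  have g1 : G (0 + 1) = qb2 q (ext0 c 0 + (ε : ℤ)) (2 * m1) := by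
    rw [hG]
    simp only [Tt, ncons]
    rw [if_neg (c := 1 < a ∧ 0 + 1 = a) (by omega)]
    simp
  have g2 : ∏ t ∈ range (k + 1), G (t + 1 + 1) = ∏ t ∈ range (k + 1),
      qb2 q (((ncons (m0 + m1) (ext0 c) t + if k + 1 - t = k + 3 - a then 1 else 0 : ℕ) : ℤ)
        + ncons (m0 + m1) (ext0 c) (t + 2)) (2 * ncons (m0 + m1) (ext0 c) (t + 1)) := by
    refine Finset.prod_congr rfl fun t ht => ?_
    have ht := Finset.mem_range.mp ht
    rw [hG]
    simp only
    rw [Tt_chain]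
    congr 1
    by_cases hc : t + 2 = a
    · rw [if_pos (c := 1 < a ∧ t + 1 + 1 = a) (by omega),
        if_pos (c := k + 1 - t = k + 3 - a) (by omega)]
      simp
      ring
    · rw [if_neg (c := 1 < a ∧ t + 1 + 1 = a) (by omega),
        if_neg (c := k + 1 - t = k + 3 - a) (by omega)]
      simp
  rw [g0, g1, g2]
  unfold Wt
  by_cases hp : ncons (m0 + m1) (ext0 c) (k + 1) % 2 = 0
  · rw [if_pos hp, if_pos hp]
    ring
  · rw [if_neg hp, if_neg hp]
    ring


/-- Weight of the first three fermionic summation variables. -/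
def hw (q h : ℝ) (ε L : ℕ) (m0 m1 m2 : ℤ) : ℝ :=
  h ^ (2 * m0 ^ 2 + 2 * m1 ^ 2 - 2 * m1 * m2 + m2 ^ 2 - 2 * (ε : ℤ) * m1)
      * qb2 q (2 * L - m2 - (ε : ℤ)) (2 * m0) * qb2 q (m2 + (ε : ℤ)) (2 * m1)

lemma hw_nonneg {q h : ℝ} (hq0 : 0 < q) (hq1 : q < 1) (hh0 : 0 < h) (ε L : ℕ) (m0 m1 m2 : ℤ) :
    0 ≤ hw q h ε L m0 m1 m2 :=
  mul_nonneg (mul_nonneg (zpow_pos hh0 _).le (qb2_nonneg hq0 hq1 _ _)) (qb2_nonneg hq0 hq1 _ _)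

lemma hw_ne {q h : ℝ} {ε L : ℕ} {m0 m1 m2 : ℤ} (hne : hw q h ε L m0 m1 m2 ≠ 0) :
    0 ≤ m0 ∧ 0 ≤ m1 ∧ 2 * m0 ≤ 2 * L - m2 - ε ∧ 2 * m1 ≤ m2 + ε ∧ (m2 + ε) % 2 = 0 := by
  have h1 := qb2_ne (right_ne_zero_of_mul hne)
  have h2 := qb2_ne (right_ne_zero_of_mul (left_ne_zero_of_mul hne))
  omega

lemma F_triple {q h : ℝ} (hq0 : 0 < q) (hq1 : q < 1) (hh0 : 0 < h) (hh : q = h ^ 4)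
    (k a L : ℕ) (ha1 : 1 ≤ a) (ha2 : a ≤ k + 2) :
    Fpoly q (k + 4) 0 a 1 L = ∑ m0 ∈ range (L + 1), ∑ m1 ∈ range (L + 1), ∑ m2 ∈ range (2 * L + 1),
      hw q h ((a + kdel a 1) % 2) L m0 m1 m2 * Gf q h (k + 3 - a) (k + 1) (m0 + m1) m2 := by
  unfold Fpoly
  rw [if_neg (by omega)]
  obtain ⟨ε, hε⟩ : ∃ ε : ℕ, ε = (a + kdel a 1) % 2 := ⟨_, rfl⟩
  rw [← hε]
  obtain ⟨T, hT⟩ : ∃ T : (Fin (k + 3) → ℕ) → ℝ, T = fun m =>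
    (if mlast (k + 4) m % 2 = 0 % 2 then
      q ^ ((PhiQ (k + 4) (Avec (k + 4) 0 a 1) m : ℝ)) *
      ∏ i : Fin (k + 3), qBinQ q (topVec (k + 4) L (uvec (k + 4) 0 a 1) m i) (m i) else 0) :=
    ⟨_, rfl⟩
  have hf : fFerm q (k + 4) 0 L (uvec (k + 4) 0 a 1) (Avec (k + 4) 0 a 1) = ∑' m, T m := by
    rw [hT]; rfl
  have hTe : ∀ (m0 m1 : ℕ) (c : Fin (k + 1) → ℕ), T (Fin.cons m0 (Fin.cons m1 c)) =
      hw q h ε L m0 m1 (ext0 c 0) * Wt q h (k + 3 - a) (k + 1) (ncons (m0 + m1) (ext0 c)) := by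
    intro m0 m1 c
    rw [hT]
    exact (term_eq hq0 hh0 hh k a L ha1 ha2 m0 m1 c).trans (by rw [← hε]; rfl)
  have hTn : ∀ m, 0 ≤ T m := by
    intro m
    rw [← Fin.cons_self_tail m, ← Fin.cons_self_tail (Fin.tail m), hTe]
    exact mul_nonneg (hw_nonneg hq0 hq1 hh0 _ _ _ _ _) (Wt_nonneg hq0 hq1 hh0 _ _ _)
  rw [hf]
  refine HasSum.tsum_eq ?_
  refine hasSum_cons T hTn (fun m0 => ∑ m1 ∈ range (L + 1), ∑ m2 ∈ range (2 * L + 1),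
      hw q h ε L m0 m1 m2 * Gf q h (k + 3 - a) (k + 1) (m0 + m1) m2) _ ?_ ?_
  swap
  · apply hasSum_range
    intro m0 hne
    obtain ⟨m1, -, hne⟩ := Finset.exists_ne_zero_of_sum_ne_zero hne
    obtain ⟨m2, -, hne⟩ := Finset.exists_ne_zero_of_sum_ne_zero hne
    have := hw_ne (left_ne_zero_of_mul hne)
    omega
  intro m0
  refine hasSum_cons _ (fun c => hTn _) (fun m1 => ∑ m2 ∈ range (2 * L + 1),
      hw q h ε L m0 m1 m2 * Gf q h (k + 3 - a) (k + 1) (m0 + m1) m2) _ ?_ ?_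
  swap
  · apply hasSum_range
    intro m1 hne
    obtain ⟨m2, -, hne⟩ := Finset.exists_ne_zero_of_sum_ne_zero hne
    have := hw_ne (left_ne_zero_of_mul hne)
    omega
  intro m1
  refine hasSum_cons _ (fun c => hTn _) (fun m2 =>
      hw q h ε L m0 m1 m2 * Gf q h (k + 3 - a) (k + 1) (m0 + m1) m2) _ ?_ ?_
  swap
  · apply hasSum_range
    intro m2 hne
    have := hw_ne (left_ne_zero_of_mul hne)
    omega
  intro m2
  have := (chain_hasSum hq0 hq1 hh0 hh (k + 3 - a) (by omega) k (m0 + m1) m2).mul_left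
    (hw q h ε L m0 m1 m2)
  refine this.congr_fun ?_
  intro c
  rw [hTe, ext0_cons]
  rfl

/-- q-Vandermonde step. -/
lemma hw_vand {q h : ℝ} (hq0 : 0 < q) (hq1 : q < 1) (hh0 : 0 < h) (hh : q = h ^ 4)
    (ε L l N m2 : ℕ) (hl : m2 + ε = 2 * l) (hlL : l ≤ L) :
    ∑ m1 ∈ range (L + 1), hw q h ε L ((N : ℤ) - m1) m1 m2
      = h ^ ((N : ℤ) ^ 2 - 2 * ε * N + ((N : ℤ) - m2) ^ 2) * qb q L N := by
  have e1 : ∑ m1 ∈ range (L + 1), hw q h ε L ((N : ℤ) - m1) m1 m2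
      = ∑ m1 ∈ range (l + 1), hw q h ε L ((N : ℤ) - m1) m1 m2 := by
    symm
    apply Finset.sum_subset (Finset.range_subset_range.mpr (by omega))
    intro m1 _ hm1
    by_contra hne
    have := hw_ne hne
    rw [Finset.mem_range] at hm1
    omega
  have hv := qvand hq0 hq1 l (L - l) ((N : ℤ) - l)
  rw [show (l : ℤ) + ((L - l : ℕ) : ℤ) = L by omega, show (l : ℤ) + ((N : ℤ) - l) = N by ring] at hv
  rw [e1, ← hv, Finset.mul_sum, ← Finset.sum_range_reflect]
  refine Finset.sum_congr rfl fun t ht => ?_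
  have ht := Finset.mem_range.mp ht
  have c1 : ((l + 1 - 1 - t : ℕ) : ℤ) = (l : ℤ) - t := by omega
  rw [c1]
  unfold hw
  rw [qb2_eq ((L - l : ℕ) : ℤ) ((t : ℤ) + ((N : ℤ) - l)) (by omega) (by ring),
    qb2_eq (l : ℤ) ((l : ℤ) - t) (by omega) (by ring), qb_symm, q_zpow hh]
  have c2 : (m2 : ℤ) = 2 * l - ε := by omega
  have c3 : h ^ (2 * ((N : ℤ) - ((l : ℤ) - t)) ^ 2 + 2 * ((l : ℤ) - t) ^ 2
      - 2 * ((l : ℤ) - t) * m2 + (m2 : ℤ) ^ 2 - 2 * (ε : ℤ) * ((l : ℤ) - t))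
      = h ^ ((N : ℤ) ^ 2 - 2 * ε * N + ((N : ℤ) - m2) ^ 2)
        * h ^ (4 * ((t : ℤ) * (t + ((N : ℤ) - l)))) := by
    rw [← zpow_add₀ hh0.ne', c2]
    congr 1
    ring
  rw [c3]
  ring

lemma sum_shift (φ : ℤ → ℕ → ℝ) (L m1 : ℕ) (hm1 : m1 ≤ L)
    (hφ : ∀ x N, φ x N ≠ 0 → 0 ≤ x ∧ x ≤ L) :
    ∑ m0 ∈ range (L + 1), φ m0 (m0 + m1) = ∑ N ∈ range (2 * L + 1), φ ((N : ℤ) - m1) N := by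
  refine Finset.sum_bij_ne_zero (fun m0 _ _ => m0 + m1) ?_ ?_ ?_ ?_
  · intro m0 h1 _; rw [Finset.mem_range] at *; omega
  · intro x _ _ y _ _ hxy; omega
  · intro N hN hne
    have := hφ _ _ hne
    refine ⟨N - m1, Finset.mem_range.mpr (by omega), ?_, by omega⟩
    rw [show ((N - m1 : ℕ) : ℤ) = (N : ℤ) - m1 by omega, show N - m1 + m1 = N by omega]
    exact hne
  · intro m0 _ _
    congr 1; push_cast; ring

lemma F_single {q h : ℝ} (hq0 : 0 < q) (hq1 : q < 1) (hh0 : 0 < h) (hh : q = h ^ 4)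
    (k a L : ℕ) (ha1 : 1 ≤ a) (ha2 : a ≤ k + 2) :
    Fpoly q (k + 4) 0 a 1 L = ∑ N ∈ range (L + 1),
      h ^ ((N : ℤ) ^ 2 - 2 * (((a + kdel a 1) % 2 : ℕ) : ℤ) * N) * qb q L N *
        ∑ m2 ∈ range (N + 1), h ^ (((N : ℤ) - m2) ^ 2) * Gf q h (k + 3 - a) (k + 1) N m2 := by
  rw [F_triple hq0 hq1 hh0 hh k a L ha1 ha2]
  obtain ⟨ε, hε⟩ : ∃ ε : ℕ, ε = (a + kdel a 1) % 2 := ⟨_, rfl⟩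
  rw [← hε]
  have hG : ∀ s n : ℕ, Gf q h (k + 3 - a) (k + 1) s n ≠ 0 → n ≤ s ∧ (n + ε) % 2 = 0 := by
    intro s n hne
    by_cases h1 : a = 1
    · have := Gf_ne1 hq0 hq1 hh0 hh (k + 3 - a) (k + 1) (by omega) s n hne
      have e : ε = 0 := by rw [hε, h1]; rfl
      omega
    · rw [show k + 1 = k + 3 - a + (a - 2) by omega] at hne
      have := Gf_ne2 hq0 hq1 hh0 hh (k + 3 - a) (by omega) (a - 2) s n hne
      have e : kdel a 1 = 0 := if_neg h1
      rw [e] at hε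
      omega
  have hε1 : ε ≤ 1 := by omega
  rw [Finset.sum_comm]
  have s1 : ∀ m1 ∈ range (L + 1), ∑ m0 ∈ range (L + 1), ∑ m2 ∈ range (2 * L + 1),
      hw q h ε L m0 m1 m2 * Gf q h (k + 3 - a) (k + 1) (m0 + m1) m2
      = ∑ N ∈ range (2 * L + 1), ∑ m2 ∈ range (2 * L + 1),
      hw q h ε L ((N : ℤ) - m1) m1 m2 * Gf q h (k + 3 - a) (k + 1) N m2 := by
    intro m1 hm1
    refine sum_shift (fun x N => ∑ m2 ∈ range (2 * L + 1),
      hw q h ε L x m1 m2 * Gf q h (k + 3 - a) (k + 1) N m2) L m1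
      (by have := Finset.mem_range.mp hm1; omega) ?_
    intro x N hne
    obtain ⟨m2, -, hne⟩ := Finset.exists_ne_zero_of_sum_ne_zero hne
    have := hw_ne (left_ne_zero_of_mul hne)
    omega
  rw [Finset.sum_congr rfl s1, Finset.sum_comm]
  have s2 : ∀ N : ℕ, ∑ m1 ∈ range (L + 1), ∑ m2 ∈ range (2 * L + 1),
      hw q h ε L ((N : ℤ) - m1) m1 m2 * Gf q h (k + 3 - a) (k + 1) N m2
      = ∑ m2 ∈ range (2 * L + 1), h ^ ((N : ℤ) ^ 2 - 2 * (ε : ℤ) * N) * qb q L N *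
        (h ^ (((N : ℤ) - m2) ^ 2) * Gf q h (k + 3 - a) (k + 1) N m2) := by
    intro N
    rw [Finset.sum_comm]
    refine Finset.sum_congr rfl fun m2 _ => ?_
    rw [← Finset.sum_mul]
    by_cases hg : Gf q h (k + 3 - a) (k + 1) N m2 = 0
    · rw [hg]; ring
    · have hg := hG _ _ hg
      obtain ⟨l, hl⟩ : ∃ l, m2 + ε = 2 * l := ⟨(m2 + ε) / 2, by omega⟩
      by_cases hlL : l ≤ L
      · rw [hw_vand hq0 hq1 hh0 hh ε L l N m2 hl hlL, zpow_add₀ hh0.ne']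
        ring
      · rw [qb_gt (show (L : ℤ) < N by omega), Finset.sum_eq_zero]
        · ring
        · intro m1 _
          by_contra hne
          have := hw_ne hne
          omega
  rw [Finset.sum_congr rfl fun N _ => s2 N]
  symm
  have s3 : ∀ N ∈ range (L + 1), h ^ ((N : ℤ) ^ 2 - 2 * (ε : ℤ) * N) * qb q L N *
        ∑ m2 ∈ range (N + 1), h ^ (((N : ℤ) - m2) ^ 2) * Gf q h (k + 3 - a) (k + 1) N m2
      = ∑ m2 ∈ range (2 * L + 1), h ^ ((N : ℤ) ^ 2 - 2 * (ε : ℤ) * N) * qb q L N *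
        (h ^ (((N : ℤ) - m2) ^ 2) * Gf q h (k + 3 - a) (k + 1) N m2) := by
    intro N hN
    have hN := Finset.mem_range.mp hN
    rw [← Finset.mul_sum]
    congr 1
    apply Finset.sum_subset (Finset.range_subset_range.mpr (by omega))
    intro m2 _ hm2
    rw [Finset.mem_range] at hm2
    by_contra hne
    have := hG _ _ (right_ne_zero_of_mul hne)
    omega
  rw [Finset.sum_congr rfl s3]
  apply Finset.sum_subset (Finset.range_subset_range.mpr (by omega))
  intro N _ hN
  rw [Finset.mem_range] at hN
  rw [qb_gt (show (L : ℤ) < N by omega)]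
  exact Finset.sum_eq_zero fun m2 _ => by ring


lemma qb2_refl (q : ℝ) (N C : ℤ) : qb2 q (2 * N) (N - C) = qb2 q (2 * N) (N + C) := by
  by_cases hp : (N - C) % 2 = 0
  · obtain ⟨j, hj⟩ : ∃ j, N - C = 2 * j := ⟨(N - C) / 2, by omega⟩
    rw [qb2_eq N j rfl hj, qb2_eq N (N - j) rfl (by omega), qb_symm]
  · unfold qb2
    rw [if_neg (by omega), if_neg (by omega)]

lemma qTri_eq {q : ℝ} (L : ℕ) (C : ℤ) :
    qTri q 0 L C = ∑ j ∈ range (L + 1), q ^ ((j : ℤ) * (j + C)) * qp q L * rp q j * rp q (j + C)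
      * rp q (L - 2 * j - C) := by
  unfold qTri
  have e : ∀ j : ℕ, (if 0 ≤ (j : ℤ) + C ∧ 0 ≤ (L : ℤ) - 2 * j - C then
        q ^ ((j : ℤ) * ((j : ℤ) + C - 0)) * qPoch q L /
          (qPoch q j * qPoch q (((j : ℤ) + C).toNat) * qPoch q (((L : ℤ) - 2 * j - C).toNat))
      else 0) = q ^ ((j : ℤ) * (j + C)) * qp q L * rp q j * rp q (j + C)
      * rp q (L - 2 * j - C) := by
    intro j
    by_cases h1 : 0 ≤ (j : ℤ) + C ∧ 0 ≤ (L : ℤ) - 2 * j - C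
    · rw [if_pos h1]
      unfold rp qp
      rw [if_pos h1.1, if_pos h1.2, if_pos (by omega), sub_zero, Int.toNat_natCast,
        Int.toNat_natCast, div_eq_mul_inv, mul_inv, mul_inv]
      ring
    · rw [if_neg h1]
      by_cases h2 : 0 ≤ (j : ℤ) + C
      · rw [rp_neg (k := (L : ℤ) - 2 * j - C) (by omega)]; ring
      · rw [rp_neg (k := (j : ℤ) + C) (by omega)]; ring
  rw [Finset.sum_congr rfl fun j _ => e j]
  by_cases hC : |C| ≤ (L : ℤ)
  · rw [if_pos hC]
  · rw [if_neg hC]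
    symm
    refine Finset.sum_eq_zero fun j _ => ?_
    by_cases h2 : 0 ≤ (j : ℤ) + C
    · rw [rp_neg (k := (L : ℤ) - 2 * j - C)]
      · ring
      · by_contra h3
        exact hC (abs_le.mpr (by omega))
    · rw [rp_neg (k := (j : ℤ) + C) (by omega)]; ring

lemma tri_sum {q h : ℝ} (hq0 : 0 < q) (hq1 : q < 1) (hh0 : 0 < h) (hh : q = h ^ 4)
    (L : ℕ) (C : ℤ) :
    ∑ N ∈ range (L + 1), h ^ ((N : ℤ) ^ 2) * qb q L N * qb2 q (2 * N) (N - C)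
      = h ^ (C ^ 2) * qTri q 0 L C := by
  rw [qTri_eq, Finset.mul_sum]
  have key : ∀ N j : ℕ, (N : ℤ) = 2 * j + C →
      h ^ ((N : ℤ) ^ 2) * qb q L N * qb2 q (2 * N) (N - C) = h ^ (C ^ 2) *
      (q ^ ((j : ℤ) * (j + C)) * qp q L * rp q j * rp q (j + C) * rp q (L - 2 * j - C)) := by
    intro N j hN
    rw [qb2_eq (N : ℤ) (j : ℤ) rfl (by omega)]
    unfold qb
    have := qp_mul_rp hq0 hq1 N (by omega)
    rw [q_zpow hh, show (L : ℤ) - N = L - 2 * j - C by omega, show (N : ℤ) - j = j + C by omega,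
      show h ^ ((N : ℤ) ^ 2) = h ^ (C ^ 2) * h ^ (4 * ((j : ℤ) * (j + C))) by
        rw [← zpow_add₀ hh0.ne', hN]; congr 1; ring]
    linear_combination (h ^ (C ^ 2) * h ^ (4 * ((j : ℤ) * (j + C))) * qp q L * rp q j
      * rp q (j + C) * rp q (L - 2 * j - C)) * this
  refine Finset.sum_bij_ne_zero (fun N _ _ => (((N : ℤ) - C) / 2).toNat) ?_ ?_ ?_ ?_
  · intro N h1 h2
    have := qb2_ne (right_ne_zero_of_mul h2)
    rw [Finset.mem_range] at *
    omega
  · intro N1 _ h1 N2 _ h2 h3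
    have := qb2_ne (right_ne_zero_of_mul h1)
    have := qb2_ne (right_ne_zero_of_mul h2)
    omega
  · intro j hj hne
    have c1 : 0 ≤ (L : ℤ) - 2 * j - C := by
      by_contra h1
      rw [rp_neg (k := (L : ℤ) - 2 * j - C) (by omega)] at hne
      simp at hne
    have c2 : 0 ≤ (j : ℤ) + C := by
      by_contra h1
      rw [rp_neg (k := (j : ℤ) + C) (by omega)] at hne
      simp at hne
    have c3 : ((2 * j + C).toNat : ℤ) = 2 * j + C := by omega
    refine ⟨(2 * j + C).toNat, Finset.mem_range.mpr (by omega), ?_, by omega⟩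
    rw [key _ j c3]
    exact hne
  · intro N _ h1
    have := qb2_ne (right_ne_zero_of_mul h1)
    exact key N _ (by omega)

lemma tri_sum2 {q h : ℝ} (hq0 : 0 < q) (hq1 : q < 1) (hh0 : 0 < h) (hh : q = h ^ 4)
    (L : ℕ) (A : ℤ) (hA : A % 2 = 0) :
    ∑ N ∈ range (L + 1), h ^ ((N : ℤ) ^ 2 - 2 * N) * qb q L N
        * (qb2 q (2 * N) (N - A) - qb2 q (2 * N) (N - (A + 2)))
      = h ^ (A ^ 2 - 2 * A) * qTri q 0 L A
        - h ^ ((A + 2) ^ 2 + 2 * (A + 2)) * qTri q 0 L (A + 2) := by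
  obtain ⟨c, rfl⟩ : ∃ c, A = 2 * c := ⟨A / 2, by omega⟩
  rw [show (2 * c) ^ 2 - 2 * (2 * c) = -(4 * c) + (2 * c) ^ 2 by ring,
    show (2 * c + 2) ^ 2 + 2 * (2 * c + 2) = (4 * c + 4) + (2 * c + 2) ^ 2 by ring,
    zpow_add₀ hh0.ne', zpow_add₀ hh0.ne', mul_assoc, mul_assoc, ← tri_sum hq0 hq1 hh0 hh,
    ← tri_sum hq0 hq1 hh0 hh, Finset.mul_sum, Finset.mul_sum, ← Finset.sum_sub_distrib]
  refine Finset.sum_congr rfl fun N _ => ?_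
  by_cases hN : (N : ℤ) % 2 = 0
  swap
  · have e1 : qb2 q (2 * N) (N - 2 * c) = 0 := by unfold qb2; rw [if_neg (by omega)]
    have e2 : qb2 q (2 * N) (N - (2 * c + 2)) = 0 := by unfold qb2; rw [if_neg (by omega)]
    rw [e1, e2]; ring
  obtain ⟨x, hx⟩ : ∃ x : ℤ, (N : ℤ) = 2 * x := ⟨N / 2, by omega⟩
  rw [qb2_eq (N : ℤ) (x - c) rfl (by omega), qb2_eq (N : ℤ) (x - c - 1) rfl (by omega)]
  have key : qb q N (x - c) * (1 - q ^ (x - c)) = qb q N (x - c - 1) * (1 - q ^ (x + c + 1)) := by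
    unfold qb
    have r1 := rp_pred hq0 hq1 (x - c)
    have r2 := rp_pred hq0 hq1 (x + c + 1)
    rw [r1, show (N : ℤ) - (x - c) = x + c + 1 - 1 by omega,
      show (N : ℤ) - (x - c - 1) = x + c + 1 by omega, r2]
    ring
  rw [q_zpow hh, q_zpow hh] at key
  have z1 : h ^ ((N : ℤ) ^ 2 - 2 * N) = h ^ ((N : ℤ) ^ 2) * h ^ (-(4 * x)) := by
    rw [← zpow_add₀ hh0.ne']; congr 1; rw [hx]; ring
  have z2 : h ^ (-(4 * c)) = h ^ (-(4 * x)) * h ^ (4 * (x - c)) := by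
    rw [← zpow_add₀ hh0.ne']; congr 1; ring
  have z3 : h ^ (4 * c + 4) = h ^ (-(4 * x)) * h ^ (4 * (x + c + 1)) := by
    rw [← zpow_add₀ hh0.ne']; congr 1; ring
  rw [z1, z2, z3]
  linear_combination (h ^ ((N : ℤ) ^ 2) * h ^ (-(4 * x)) * qb q L N) * key

lemma sum_Icc_reflect (f : ℤ → ℝ) (R : ℕ) :
    ∑ r ∈ Icc (-(R : ℤ)) R, f (-r) = ∑ r ∈ Icc (-(R : ℤ)) R, f r := by
  refine Finset.sum_nbij' (fun r => -r) (fun r => -r) ?_ ?_ ?_ ?_ ?_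
  · intro r hr; rw [Finset.mem_Icc] at *; omega
  · intro r hr; rw [Finset.mem_Icc] at *; omega
  · intro r _; simp
  · intro r _; simp
  · intro r _; rfl

lemma split_sum (s : Finset ℕ) (f g1 g2 : ℕ → ℝ) (c1 c2 : ℝ) :
    ∑ n ∈ s, f n * (c1 * g1 n - c2 * g2 n)
      = c1 * ∑ n ∈ s, f n * g1 n - c2 * ∑ n ∈ s, f n * g2 n := by
  rw [Finset.mul_sum, Finset.mul_sum, ← Finset.sum_sub_distrib]
  refine Finset.sum_congr rfl fun n _ => ?_
  ring

lemma inner_eq {q h : ℝ} (hq0 : 0 < q) (hq1 : q < 1) (hh0 : 0 < h) (hh : q = h ^ 4)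
    (k a : ℕ) (ha1 : 1 ≤ a) (ha2 : a ≤ k + 2) (N R : ℕ) (hR : N + 2 ≤ R) (P : ℤ)
    (hP : P = k + 4) :
    ∑ m2 ∈ range (N + 1), h ^ (((N : ℤ) - m2) ^ 2) * Gf q h (k + 3 - a) (k + 1) N m2
      = ∑ r ∈ Icc (-(R : ℤ)) R, h ^ (4 * ((P - a + 1) * r ^ 2 + r) + (a - 1) * (2 * r + 1) ^ 2)
        * (qb2 q (2 * N) (N - (2 * P * r + a - 1)) - qb2 q (2 * N) (N - (2 * P * r + a - 1 + 2))) := by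
  have main : ∑ m2 ∈ range (N + 1), h ^ (((N : ℤ) - m2) ^ 2) * Gf q h (k + 3 - a) (k + 1) N m2
      = ∑ r ∈ Icc (-(R : ℤ)) R,
        (h ^ (4 * ((P - a + 1) * r ^ 2 - r) + (a - 1) * (2 * r - 1) ^ 2)
          * qb2 q (2 * N) (N - (2 * P * r - a + 1))
        - h ^ (4 * ((P - a + 1) * r ^ 2 + r) + (a - 1) * (2 * r + 1) ^ 2)
          * qb2 q (2 * N) (N - (2 * P * r + a - 1 + 2))) := by
    by_cases h1 : a = 1
    · rw [Finset.sum_congr rfl fun n1 hn1 => by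
        rw [Gf_E hq0 hq1 hh0 hh (k + 3 - a) R (k + 1) (by omega) N n1
          (by have := Finset.mem_range.mp hn1; omega), Finset.mul_sum]]
      rw [Finset.sum_comm]
      refine Finset.sum_congr rfl fun r _ => ?_
      unfold Et
      obtain ⟨K, hK⟩ : ∃ K : ℤ, K = ((k + 1 : ℕ) : ℤ) + 2 := ⟨_, rfl⟩
      rw [← hK]
      have hK1 : 1 ≤ K := by rw [hK]; omega
      have b1 := burge_inf hq0 hq1 hh0 hh N _ _ (Et_sign1 K r hK1)
      have b2 := burge_inf hq0 hq1 hh0 hh N _ _ (Et_sign2 K r hK1)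
      rw [split_sum, b1, b2, ← mul_assoc,
        ← mul_assoc, ← zpow_add₀ hh0.ne', ← zpow_add₀ hh0.ne']
      have hPK : P = K + 1 := by rw [hP, hK]; push_cast; ring
      rw [h1, hPK]
      congr 3 <;> (push_cast; ring)
    · obtain ⟨m, hm⟩ : ∃ m, a = m + 2 := ⟨a - 2, by omega⟩
      obtain ⟨σ, hσ⟩ : ∃ σ, σ = k + 3 - a := ⟨_, rfl⟩
      rw [← hσ, show k + 1 = σ + m by omega]
      rw [Finset.sum_congr rfl fun n1 hn1 => by
        rw [Gf_Es hq0 hq1 hh0 hh σ R (by omega) m N n1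
          (by have := Finset.mem_range.mp hn1; omega), Finset.mul_sum]]
      rw [Finset.sum_comm]
      refine Finset.sum_congr rfl fun r _ => ?_
      unfold Est
      obtain ⟨K, hK⟩ : ∃ K : ℤ, K = (σ : ℤ) + 2 := ⟨_, rfl⟩
      rw [← hK]
      have b1 := burge_inf hq0 hq1 hh0 hh N _ _ (Est_sign1 K m r (by omega) (by omega))
      have b2 := burge_inf hq0 hq1 hh0 hh N _ _ (Est_sign2 K m r (by omega) (by omega))
      rw [split_sum, b1, b2, ← mul_assoc,
        ← mul_assoc, ← zpow_add₀ hh0.ne', ← zpow_add₀ hh0.ne']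
      have hPK : P = K + m + 1 := by rw [hP, hK]; omega
      rw [hm, hPK]
      congr 3 <;> (push_cast; ring)
  rw [main, Finset.sum_sub_distrib, ← sum_Icc_reflect, ← Finset.sum_sub_distrib]
  refine Finset.sum_congr rfl fun r _ => ?_
  rw [show 4 * ((P - a + 1) * (-r) ^ 2 - -r) + ((a : ℤ) - 1) * (2 * -r - 1) ^ 2
    = 4 * ((P - a + 1) * r ^ 2 + r) + (a - 1) * (2 * r + 1) ^ 2 by ring,
    show (N : ℤ) - (2 * P * -r - a + 1) = N + (2 * P * r + a - 1) by ring, ← qb2_refl]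
  ring


lemma F_double {q h : ℝ} (hq0 : 0 < q) (hq1 : q < 1) (hh0 : 0 < h) (hh : q = h ^ 4)
    (k a L : ℕ) (ha1 : 1 ≤ a) (ha2 : a ≤ k + 2) (P : ℤ) (hP : P = k + 4) :
    Fpoly q (k + 4) 0 a 1 L
      = ∑ r ∈ Icc (-((L + 2 : ℕ) : ℤ)) ((L + 2 : ℕ) : ℤ),
        h ^ (4 * ((P - a + 1) * r ^ 2 + r) + ((a : ℤ) - 1) * (2 * r + 1) ^ 2)
        * ∑ N ∈ range (L + 1), h ^ ((N : ℤ) ^ 2 - 2 * (((a + kdel a 1) % 2 : ℕ) : ℤ) * N)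
          * qb q L N * (qb2 q (2 * N) (N - (2 * P * r + a - 1))
            - qb2 q (2 * N) (N - (2 * P * r + a - 1 + 2))) := by
  rw [F_single hq0 hq1 hh0 hh k a L ha1 ha2]
  have e : ∀ N ∈ range (L + 1),
      h ^ ((N : ℤ) ^ 2 - 2 * (((a + kdel a 1) % 2 : ℕ) : ℤ) * N) * qb q L N
        * ∑ m2 ∈ range (N + 1), h ^ (((N : ℤ) - m2) ^ 2) * Gf q h (k + 3 - a) (k + 1) N m2
      = ∑ r ∈ Icc (-((L + 2 : ℕ) : ℤ)) ((L + 2 : ℕ) : ℤ),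
        h ^ (4 * ((P - a + 1) * r ^ 2 + r) + ((a : ℤ) - 1) * (2 * r + 1) ^ 2)
        * (h ^ ((N : ℤ) ^ 2 - 2 * (((a + kdel a 1) % 2 : ℕ) : ℤ) * N)
          * qb q L N * (qb2 q (2 * N) (N - (2 * P * r + a - 1))
            - qb2 q (2 * N) (N - (2 * P * r + a - 1 + 2)))) := by
    intro N hN
    have hN := Finset.mem_range.mp hN
    rw [inner_eq hq0 hq1 hh0 hh k a ha1 ha2 N (L + 2) (by omega) P hP, Finset.mul_sum]
    refine Finset.sum_congr rfl fun r _ => ?_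
    ring
  rw [Finset.sum_congr rfl e, Finset.sum_comm]
  refine Finset.sum_congr rfl fun r _ => ?_
  rw [Finset.mul_sum]

lemma qTri_zero (q : ℝ) (n : ℤ) (L : ℕ) (A : ℤ) (hA : (L : ℤ) < A ∨ A < -(L : ℤ)) :
    qTri q n L A = 0 := by
  unfold qTri
  rw [if_neg]
  rw [abs_le]
  omega

lemma Bpoly_fin (q : ℝ) (P a s : ℤ) (L : ℕ) (ha1 : 1 ≤ a) (ha2 : a + 1 ≤ P) :
    Bpoly q P a 1 s L = ∑ j ∈ Icc (-((L + 2 : ℕ) : ℤ)) ((L + 2 : ℕ) : ℤ),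
      (q ^ (P * (P + 1) * j ^ 2 + j * ((P + 1) * a - P * s)) * qTri q 0 L (2 * P * j + a - 1)
      - q ^ ((P * j + a) * ((P + 1) * j + s)) * qTri q 0 L (2 * P * j + a + 1)) := by
  unfold Bpoly
  refine tsum_eq_sum fun j hj => ?_
  rw [Finset.mem_Icc] at hj
  have hj' : (L : ℤ) + 3 ≤ j ∨ j ≤ -(L : ℤ) - 3 := by push_cast at hj; omega
  rcases hj' with h1 | h1
  · have : j ≤ P * j := by nlinarith
    rw [qTri_zero q 0 L (2 * P * j + a - 1) (by left; linarith),
      qTri_zero q 0 L (2 * P * j + a + 1) (by left; linarith)]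
    ring
  · have : P * (2 * j + 1) ≤ 2 * j + 1 := by nlinarith
    rw [qTri_zero q 0 L (2 * P * j + a - 1) (by right; linarith),
      qTri_zero q 0 L (2 * P * j + a + 1) (by right; linarith)]
    ring

lemma real_distrib (x y t z u : ℝ) : x * (y * t - z * u) = x * y * t - x * z * u := by ring

lemma F_even {q h : ℝ} (hq0 : 0 < q) (hq1 : q < 1) (hh0 : 0 < h) (hh : q = h ^ 4)
    (k a L : ℕ) (ha1 : 1 ≤ a) (ha2 : a ≤ k + 2) (he : (a + kdel a 1) % 2 = 0) :
    Fpoly q (k + 4) 0 a 1 L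
      = h ^ ((a : ℤ) * (a - 1)) * Bpoly q ((k + 4 : ℕ) : ℤ) a 1 1 L := by
  obtain ⟨P, hP⟩ : ∃ P : ℤ, P = ((k + 4 : ℕ) : ℤ) := ⟨_, rfl⟩
  rw [← hP, F_double hq0 hq1 hh0 hh k a L ha1 ha2 P (by rw [hP]; push_cast; ring), he,
    Bpoly_fin q P a 1 L (by omega) (by omega), Finset.mul_sum]
  refine Finset.sum_congr rfl fun r _ => ?_
  have e : ∀ A : ℤ, ∑ N ∈ range (L + 1), h ^ ((N : ℤ) ^ 2 - 2 * ((0 : ℕ) : ℤ) * N)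
      * qb q L N * (qb2 q (2 * N) (N - A) - qb2 q (2 * N) (N - (A + 2)))
      = h ^ (A ^ 2) * qTri q 0 L A - h ^ ((A + 2) ^ 2) * qTri q 0 L (A + 2) := by
    intro A
    rw [← tri_sum hq0 hq1 hh0 hh, ← tri_sum hq0 hq1 hh0 hh, ← Finset.sum_sub_distrib]
    refine Finset.sum_congr rfl fun N _ => ?_
    rw [show (N : ℤ) ^ 2 - 2 * ((0 : ℕ) : ℤ) * N = (N : ℤ) ^ 2 by push_cast; ring]
    ring
  rw [e, q_zpow hh, q_zpow hh, real_distrib, real_distrib, ← zpow_add₀ hh0.ne', ← zpow_add₀ hh0.ne', ← zpow_add₀ hh0.ne',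
    ← zpow_add₀ hh0.ne', show 2 * P * r + (a : ℤ) - 1 + 2 = 2 * P * r + a + 1 by ring]
  congr 3 <;> ring

lemma F_odd {q h : ℝ} (hq0 : 0 < q) (hq1 : q < 1) (hh0 : 0 < h) (hh : q = h ^ 4)
    (k a L : ℕ) (ha1 : 1 ≤ a) (ha2 : a ≤ k + 2) (he : (a + kdel a 1) % 2 = 1) :
    Fpoly q (k + 4) 0 a 1 L
      = h ^ (((a : ℤ) - 1) * (a - 2)) * Bpoly q ((k + 4 : ℕ) : ℤ) a 1 2 L := by
  have hodd : a % 2 = 1 := by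
    unfold kdel at he
    split_ifs at he <;> omega
  obtain ⟨P, hP⟩ : ∃ P : ℤ, P = ((k + 4 : ℕ) : ℤ) := ⟨_, rfl⟩
  rw [← hP, F_double hq0 hq1 hh0 hh k a L ha1 ha2 P (by rw [hP]; push_cast; ring), he,
    Bpoly_fin q P a 2 L (by omega) (by omega), Finset.mul_sum]
  refine Finset.sum_congr rfl fun r _ => ?_
  have hev : (2 * P * r + (a : ℤ) - 1) % 2 = 0 := by
    rw [mul_assoc]; omega
  have e := tri_sum2 hq0 hq1 hh0 hh L (2 * P * r + a - 1) hev
  rw [Nat.cast_one, mul_one, e, q_zpow hh, q_zpow hh, real_distrib, real_distrib, ← zpow_add₀ hh0.ne', ← zpow_add₀ hh0.ne', ← zpow_add₀ hh0.ne',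
    ← zpow_add₀ hh0.ne', show 2 * P * r + (a : ℤ) - 1 + 2 = 2 * P * r + a + 1 by ring]
  congr 3 <;> ring


/-- For `p ≥ 4`, `1 ≤ a ≤ p-2`, `L ≥ 0` and `0 < q < 1`:
if `a + δ_{a,1}` is even then `F^{p,0}_{a,1}(L) = q^{a(a-1)/4} B^p_{a,1}(L,1)`,
and if `a + δ_{a,1}` is odd then `F^{p,0}_{a,1}(L) = q^{(a-1)(a-2)/4} B^p_{a,1}(L,2)`. -/
theorem even_identity_b_eq_one (p a : ℕ) (hp : 4 ≤ p) (ha1 : 1 ≤ a) (ha2 : a ≤ p - 2)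
    (L : ℕ) (q : ℝ) (hq0 : 0 < q) (hq1 : q < 1) :
    ((a + kdel a 1) % 2 = 0 →
      Fpoly q p 0 a 1 L = q ^ ((a : ℝ) * ((a : ℝ) - 1) / 4) * Bpoly q p a 1 1 L) ∧
    ((a + kdel a 1) % 2 = 1 →
      Fpoly q p 0 a 1 L = q ^ (((a : ℝ) - 1) * ((a : ℝ) - 2) / 4) * Bpoly q p a 1 2 L) := by
  obtain ⟨k, rfl⟩ : ∃ k, p = k + 4 := ⟨p - 4, by omega⟩
  obtain ⟨h, hdef⟩ : ∃ h : ℝ, h = q ^ ((1 : ℝ) / 4) := ⟨_, rfl⟩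
  have hh0 : 0 < h := by rw [hdef]; exact Real.rpow_pos_of_pos hq0 _
  have hh : q = h ^ 4 := by
    rw [hdef, ← Real.rpow_natCast, ← Real.rpow_mul hq0.le]
    norm_num
  have hpow : ∀ z : ℤ, q ^ ((z : ℝ) / 4) = h ^ z := by
    intro z
    rw [hdef, ← Real.rpow_intCast, ← Real.rpow_mul hq0.le]
    congr 1
    ring
  constructor
  · intro he
    rw [F_even hq0 hq1 hh0 hh k a L ha1 (by omega) he, ← hpow]
    push_cast
    rfl
  · intro he
    rw [F_odd hq0 hq1 hh0 hh k a L ha1 (by omega) he, ← hpow]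
    push_cast
    rfl
end
end
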